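/- arXiv:2603.05739 — 10 statements merged into one kernel-verified Lean document; each statement's English description precedes it below -/
import Mathlib

section
/- There is a universal constant C > 0 with the following property. Let Y be a measurable space, π_ref a probability measure on Y, r⋆, r̂ : Y → ℝ measurable reward functions, π⋆ a probability measure on Y with π⋆ ≪ π_ref, and N ≥ 1 an integer. Write ε = ε_pw(r̂) and assume 0 < ε ≤ e^{−1}. Then the Best-of-N policy π_BoN satisfies R^{r⋆}(π⋆) − R^{r⋆}(π_BoN) ≤ C·( N·ε·log(1/ε) + E_{N/log(1/ε)}(π⋆ ‖ π_ref) ). -/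
open MeasureTheory ENNReal

noncomputable section

section Defs

variable {Y : Type*} [MeasurableSpace Y]

/-- Pairwise comparison outcome `φ_r(y,y')`. -/
def phi (r : Y → ℝ) (y y' : Y) : ℝ :=
  (if r y' < r y then 1 else 0) + (1 / 2) * (if r y = r y' then 1 else 0)

/-- Win-rate of `π` against comparison measure `q` under reward `r`. -/
def winRateQ (q : Measure Y) (r : Y → ℝ) (π : Measure Y) : ℝ :=
  ∫ y, ∫ y', phi r y y' ∂q ∂π

/-- Win-rate of `π` against `πref` under reward `r`. -/
def winRate (πref : Measure Y) (r : Y → ℝ) (π : Measure Y) : ℝ :=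
  winRateQ πref r π

/-- Pairwise win-rate error of `rhat` w.r.t. true reward `rstar` under `πref`. -/
def epw (πref : Measure Y) (rhat rstar : Y → ℝ) : ℝ :=
  ∫ y, ∫ y', |phi rhat y y' - phi rstar y y'| ∂πref ∂πref

/-- `E_M` divergence. -/
def EMdiv (M : ℝ) (ν μ : Measure Y) : ℝ :=
  ∫ y, max ((ν.rnDeriv μ y).toReal - M) 0 ∂μ

/-- Best-of-N selection map: returns `ys i` for the least index `i` attaining the
maximum of `rhat` over the batch. -/
def bonSelect (rhat : Y → ℝ) (N : ℕ) (hN : 0 < N) (ys : Fin N → Y) : Y :=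
  ys ((Finset.univ.filter fun i => ∀ j, rhat (ys j) ≤ rhat (ys i)).min'
    (by
      obtain ⟨i, -, hi⟩ :=
        Finset.exists_max_image (Finset.univ : Finset (Fin N)) (fun i => rhat (ys i))
          ⟨⟨0, hN⟩, Finset.mem_univ _⟩
      exact ⟨i, Finset.mem_filter.mpr ⟨Finset.mem_univ _, fun j => hi j (Finset.mem_univ _)⟩⟩))

/-- The Best-of-N policy: pushforward of `πref^{⊗N}` under the selection map. -/
def bonPolicy (πref : Measure Y) (rhat : Y → ℝ) (N : ℕ) (hN : 0 < N) : Measure Y :=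
  Measure.map (bonSelect rhat N hN) (Measure.pi fun _ : Fin N => πref)

/-- Uniform distribution on `[0,1]`. -/
def unif01 : Measure ℝ := (volume : Measure ℝ).restrict (Set.Icc 0 1)

/-- Indices whose tie-broken pair `(rhat (ys i'), vs i')` is lexicographically strictly
above that of `i` (final ties broken by index). -/
def lexAbove (rhat : Y → ℝ) {N : ℕ} (ys : Fin N → Y) (vs : Fin N → ℝ) (i : Fin N) :
    Finset (Fin N) :=
  Finset.univ.filter fun i' =>
    rhat (ys i) < rhat (ys i') ∨
      (rhat (ys i) = rhat (ys i') ∧ (vs i < vs i' ∨ (vs i = vs i' ∧ i' < i)))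

/-- The empirical `E_M`-regularized Best-of-N policy: draw `N` i.i.d. samples from `πref`
and independent uniform tie-breakers, and output a uniformly random element among the
top-`k` samples in the lexicographic order on `(rhat (y i), V i)`. -/
def empPolicy (πref : Measure Y) (rhat : Y → ℝ) (N k : ℕ) : Measure Y :=
  (k : ℝ≥0∞)⁻¹ • ∑ i : Fin N,
    Measure.map (fun ω : (Fin N → Y) × (Fin N → ℝ) => ω.1 i)
      (((Measure.pi fun _ : Fin N => πref).prod (Measure.pi fun _ : Fin N => unif01)).restrict
        {ω : (Fin N → Y) × (Fin N → ℝ) | (lexAbove rhat ω.1 ω.2 i).card < k})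

/-- Total variation distance. -/
def TV (μ ν : Measure Y) : ℝ :=
  ⨆ A : {A : Set Y // MeasurableSet A}, |(μ A.1).toReal - (ν A.1).toReal|

end Defs

section Helpers
set_option linter.unusedSectionVars false
variable {Y : Type*} [MeasurableSpace Y]

lemma measurable_phi (r : Y → ℝ) (hr : Measurable r) :
    Measurable (fun z : Y × Y => phi r z.1 z.2) := by
  unfold phi
  have h1 : Measurable (fun z : Y × Y => r z.1) := hr.comp measurable_fst
  have h2 : Measurable (fun z : Y × Y => r z.2) := hr.comp measurable_snd
  exact (Measurable.ite (measurableSet_lt h2 h1) measurable_const measurable_const).add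
    ((Measurable.ite (measurableSet_eq_fun h1 h2) measurable_const measurable_const).const_mul _)

lemma phi_nonneg (r : Y → ℝ) (y y' : Y) : 0 ≤ phi r y y' := by
  unfold phi; split_ifs <;> norm_num

lemma phi_le_one (r : Y → ℝ) (y y' : Y) : phi r y y' ≤ 1 := by
  unfold phi; split_ifs with h1 h2 <;> first | (norm_num; done) | (exfalso; linarith)

lemma phi_mono (r : Y → ℝ) (x y y' : Y) (h : r x ≤ r y) : phi r x y' ≤ phi r y y' := by
  unfold phi; split_ifs <;> first | (norm_num; done) | (exfalso; grind)

def Fr (μ : Measure Y) (r : Y → ℝ) (y : Y) : ℝ := ∫ y', phi r y y' ∂μ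

variable (μ : Measure Y) [IsProbabilityMeasure μ]

lemma phi_int (r : Y → ℝ) (hr : Measurable r) (y : Y) : Integrable (phi r y) μ :=
  Integrable.of_mem_Icc 0 1 ((measurable_phi r hr).comp measurable_prodMk_left).aemeasurable
    (ae_of_all _ fun y' => ⟨phi_nonneg r y y', phi_le_one r y y'⟩)

lemma Fr_meas (r : Y → ℝ) (hr : Measurable r) : Measurable (Fr μ r) :=
  ((measurable_phi r hr).stronglyMeasurable.integral_prod_right (ν := μ)).measurable

lemma Fr_nonneg (r : Y → ℝ) (y : Y) : 0 ≤ Fr μ r y := integral_nonneg fun _ => phi_nonneg _ _ _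

lemma Fr_le_one (r : Y → ℝ) (hr : Measurable r) (y : Y) : Fr μ r y ≤ 1 := by
  have := integral_mono (phi_int μ r hr y) (integrable_const (1:ℝ)) (fun y' => phi_le_one r y y')
  simpa [Fr] using this

lemma Fr_mono (r : Y → ℝ) (hr : Measurable r) (x y : Y) (h : r x ≤ r y) : Fr μ r x ≤ Fr μ r y :=
  integral_mono (phi_int μ r hr x) (phi_int μ r hr y) (fun y' => phi_mono r x y y' h)

lemma Fr_int (r : Y → ℝ) (hr : Measurable r) (ν : Measure Y) [IsFiniteMeasure ν] :
    Integrable (Fr μ r) ν :=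
  Integrable.of_mem_Icc 0 1 (Fr_meas μ r hr).aemeasurable
    (ae_of_all _ fun y => ⟨Fr_nonneg μ r y, Fr_le_one μ r hr y⟩)

lemma Fr_diff (r s : Y → ℝ) (hr : Measurable r) (hs : Measurable s) :
    ∫ y, |Fr μ r y - Fr μ s y| ∂μ ≤ epw μ r s := by
  have hm : Measurable (fun z : Y × Y => |phi r z.1 z.2 - phi s z.1 z.2|) :=
    ((measurable_phi r hr).sub (measurable_phi s hs)).abs
  have hb : ∀ y y', |phi r y y' - phi s y y'| ∈ Set.Icc (0:ℝ) 1 := fun y y' =>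
    ⟨abs_nonneg _, abs_le.2 ⟨by linarith [phi_nonneg r y y', phi_le_one s y y'],
      by linarith [phi_nonneg s y y', phi_le_one r y y']⟩⟩
  have hi : Integrable (fun z : Y × Y => |phi r z.1 z.2 - phi s z.1 z.2|) (μ.prod μ) :=
    Integrable.of_mem_Icc 0 1 hm.aemeasurable (ae_of_all _ fun z => hb _ _)
  refine integral_mono ((Fr_int μ r hr μ).sub (Fr_int μ s hs μ)).abs hi.integral_prod_left ?_
  intro y
  simp only [Fr]
  rw [← integral_sub (phi_int μ r hr y) (phi_int μ s hs y)]
  exact abs_integral_le_integral_abs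

/-- layer cake comparison -/
lemma layer (ν β : Measure Y) [IsFiniteMeasure ν] [IsFiniteMeasure β] (f : Y → ℝ)
    (hf : Measurable f) (h0 : ∀ y, 0 ≤ f y) (h1 : ∀ y, f y ≤ 1) (ε : ℝ)
    (h : ∀ t, ν.real {y | t ≤ f y} ≤ β.real {y | t ≤ f y} + ε) :
    ∫ y, f y ∂ν ≤ ∫ y, f y ∂β + ε := by
  have key : ∀ (ρ : Measure Y) [IsFiniteMeasure ρ],
      ∫ y, f y ∂ρ = ∫ t in Set.Ioc 0 1, ρ.real {y | t ≤ f y} := by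
    intro ρ _
    have hi : Integrable f ρ := Integrable.of_mem_Icc 0 1 hf.aemeasurable
      (ae_of_all _ fun y => ⟨h0 y, h1 y⟩)
    exact hi.integral_eq_integral_Ioc_meas_le (ae_of_all _ h0) (ae_of_all _ h1)
  have hint : ∀ (ρ : Measure Y) [IsFiniteMeasure ρ],
      IntegrableOn (fun t : ℝ => ρ.real {y | t ≤ f y}) (Set.Ioc 0 1) := by
    intro ρ _
    have ha : Antitone (fun t : ℝ => ρ.real {y | t ≤ f y}) := fun s t hst =>
      measureReal_mono (fun y hy => le_trans hst hy)
    exact ((ha.antitoneOn _).integrableOn_isCompact isCompact_Icc).mono_set Set.Ioc_subset_Icc_self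
  rw [key ν, key β]
  have := setIntegral_mono_on (hint ν) ((hint β).add (integrableOn_const (C := ε) (by simp)))
    measurableSet_Ioc (fun t _ => h t)
  refine this.trans ?_
  simp only [Pi.add_apply]
  rw [integral_add (hint β) (by exact (integrableOn_const (by simp)))]
  simp

lemma bonSelect_spec (r : Y → ℝ) (N : ℕ) (hN : 0 < N) (ys : Fin N → Y) :
    ∃ i, bonSelect r N hN ys = ys i ∧ (∀ j, r (ys j) ≤ r (ys i)) ∧
      ∀ k, (∀ j, r (ys j) ≤ r (ys k)) → i ≤ k := by
  have hne : (Finset.univ.filter fun i => ∀ j, r (ys j) ≤ r (ys i)).Nonempty := by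
      obtain ⟨i, -, hi⟩ :=
        Finset.exists_max_image (Finset.univ : Finset (Fin N)) (fun i => r (ys i))
          ⟨⟨0, hN⟩, Finset.mem_univ _⟩
      exact ⟨i, Finset.mem_filter.mpr ⟨Finset.mem_univ _, fun j => hi j (Finset.mem_univ _)⟩⟩
  refine ⟨_, rfl, (Finset.mem_filter.1 (Finset.min'_mem _ hne)).2, fun k hk => ?_⟩
  exact Finset.min'_le _ _ (Finset.mem_filter.2 ⟨Finset.mem_univ _, hk⟩)

lemma bonSelect_mem (r : Y → ℝ) (N : ℕ) (hN : 0 < N) (ys : Fin N → Y) :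
    ∃ i, bonSelect r N hN ys = ys i ∧ ∀ j, r (ys j) ≤ r (ys i) := by
  obtain ⟨i, h1, h2, -⟩ := bonSelect_spec r N hN ys
  exact ⟨i, h1, h2⟩

lemma bon_meas (r : Y → ℝ) (hr : Measurable r) (N : ℕ) (hN : 0 < N) :
    Measurable (bonSelect r N hN) := by
  intro S hS
  have hmax : ∀ i : Fin N, MeasurableSet {ys : Fin N → Y | ∀ j, r (ys j) ≤ r (ys i)} := by
    intro i
    have : {ys : Fin N → Y | ∀ j, r (ys j) ≤ r (ys i)} = ⋂ j, {ys | r (ys j) ≤ r (ys i)} := by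
      ext; simp
    rw [this]
    exact MeasurableSet.iInter fun j => measurableSet_le (hr.comp (measurable_pi_apply j))
      (hr.comp (measurable_pi_apply i))
  have : bonSelect r N hN ⁻¹' S = ⋃ i : Fin N, (((fun ys : Fin N → Y => ys i) ⁻¹' S ∩
      {ys : Fin N → Y | ∀ j, r (ys j) ≤ r (ys i)}) ∩
      ⋂ k : Fin N, ⋂ _ : k < i, {ys : Fin N → Y | ∀ j, r (ys j) ≤ r (ys k)}ᶜ) := by
    ext ys
    obtain ⟨i, hi, hm, hmin⟩ := bonSelect_spec r N hN ys
    simp only [Set.mem_preimage, Set.mem_iUnion, Set.mem_inter_iff, Set.mem_iInter,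
      Set.mem_compl_iff, Set.mem_ofPred_eq, hi]
    constructor
    · intro h
      exact ⟨i, ⟨h, hm⟩, fun k hk hk' => absurd (hmin k hk') (not_le.2 hk)⟩
    · rintro ⟨i', ⟨h, hm'⟩, hlt⟩
      have h1 := hmin i' hm'
      have h2 : ¬ i < i' := fun hh => hlt i hh hm
      have : i = i' := le_antisymm h1 (not_lt.1 h2)
      rw [this]; exact h
  rw [this]
  exact MeasurableSet.iUnion fun i => (((measurable_pi_apply i) hS).inter (hmax i)).inter
    (MeasurableSet.iInter fun k => MeasurableSet.iInter fun _ => (hmax k).compl)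

lemma bon_le (r : Y → ℝ) (hr : Measurable r) (N : ℕ) (hN : 0 < N) :
    bonPolicy μ r N hN ≤ (N : ℝ≥0∞) • μ := by
  refine Measure.le_iff.2 fun S hS => ?_
  unfold bonPolicy
  rw [Measure.map_apply (bon_meas r hr N hN) hS]
  calc (Measure.pi fun _ : Fin N => μ) (bonSelect r N hN ⁻¹' S)
      ≤ (Measure.pi fun _ : Fin N => μ) (⋃ i : Fin N, (Function.eval i) ⁻¹' S) := by
        refine measure_mono fun ys hy => ?_
        obtain ⟨i, hi, -⟩ := bonSelect_mem r N hN ys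
        refine Set.mem_iUnion.2 ⟨i, ?_⟩
        simpa [← hi] using hy
    _ ≤ ∑ i : Fin N, (Measure.pi fun _ : Fin N => μ) ((Function.eval i) ⁻¹' S) :=
        measure_iUnion_fintype_le _ _
    _ = ∑ i : Fin N, μ S := by
        refine Finset.sum_congr rfl fun i _ => ?_
        exact (measurePreserving_eval (fun _ : Fin N => μ) i).measure_preimage hS.nullMeasurableSet
    _ = _ := by simp

lemma bon_tail (r : Y → ℝ) (hr : Measurable r) (N : ℕ) (hN : 0 < N) (t : ℝ) :
    1 - (1 - μ.real {y | t ≤ Fr μ r y}) ^ N ≤ (bonPolicy μ r N hN).real {y | t ≤ Fr μ r y} := by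
  have hS : MeasurableSet {y | t ≤ Fr μ r y} := measurableSet_le measurable_const (Fr_meas μ r hr)
  have : IsProbabilityMeasure (bonPolicy μ r N hN) :=
    Measure.isProbabilityMeasure_map (bon_meas r hr N hN).aemeasurable
  rw [← probReal_compl_eq_one_sub hS]
  have h2 := probReal_compl_eq_one_sub (μ := bonPolicy μ r N hN) hS
  suffices (bonPolicy μ r N hN).real {y | t ≤ Fr μ r y}ᶜ ≤ μ.real {y | t ≤ Fr μ r y}ᶜ ^ N by
    linarith
  unfold bonPolicy
  rw [map_measureReal_apply (bon_meas r hr N hN) hS.compl]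
  have h3 : (Measure.pi fun _ : Fin N => μ).real (Set.univ.pi fun _ => {y | t ≤ Fr μ r y}ᶜ)
      = μ.real {y | t ≤ Fr μ r y}ᶜ ^ N := by
    simp [Measure.real, Measure.pi_pi]
  rw [← h3]
  refine measureReal_mono fun ys hy => ?_
  obtain ⟨i, hi, hm⟩ := bonSelect_mem r N hN ys
  simp only [Set.mem_preimage, hi, Set.mem_compl_iff, Set.mem_ofPred_eq, not_le] at hy
  intro j _
  simp only [Set.mem_compl_iff, Set.mem_ofPred_eq, not_le]
  exact (Fr_mono μ r hr _ _ (hm j)).trans_lt hy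

lemma scalar (N : ℕ) (ε L q x : ℝ) (hL : L = Real.log (1 / ε)) (he : 0 < ε) (hL1 : 1 ≤ L)
    (hq0 : 0 ≤ q) (hq1 : q ≤ 1) (hx1 : x ≤ 1) (hxM : x ≤ (N / L) * q) :
    x ≤ 1 - (1 - q) ^ N + ε := by
  have hLe : Real.exp (-L) = ε := by
    rw [hL, one_div, Real.log_inv, neg_neg, Real.exp_log he]
  have hpow : (1 - q) ^ N ≤ Real.exp (-(N * q)) := by
    have : (1 - q) ≤ Real.exp (-q) := by linarith [Real.add_one_le_exp (-q)]
    calc (1 - q) ^ N ≤ Real.exp (-q) ^ N := pow_le_pow_left₀ (by linarith) this N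
      _ = _ := by rw [← Real.exp_nat_mul]; ring_nf
  have hL0 : 0 < L := by linarith
  set w := (N / L) * q with hw
  have hwL : N * q = w * L := by rw [hw]; field_simp
  have hw0 : 0 ≤ w := by positivity
  rw [hwL] at hpow
  rcases le_total 1 w with h | h
  · have : Real.exp (-(w * L)) ≤ Real.exp (-L) := Real.exp_le_exp.2 (by nlinarith)
    linarith
  · have hc := convexOn_exp.2 (Set.mem_univ (0:ℝ)) (Set.mem_univ (-L)) (sub_nonneg.2 h) hw0 (by ring)
    simp only [smul_eq_mul, Real.exp_zero, mul_zero, zero_add, hLe, mul_neg] at hc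
    nlinarith

lemma main_bound (rstar rhat : Y → ℝ) (hs : Measurable rstar) (hh : Measurable rhat)
    (πstar : Measure Y) [IsProbabilityMeasure πstar] (hac : πstar ≪ μ)
    (N : ℕ) (hN : 0 < N) (ε : ℝ) (he : ε = epw μ rhat rstar) (h0 : 0 < ε)
    (h1 : ε ≤ Real.exp (-1)) :
    winRate μ rstar πstar - winRate μ rstar (bonPolicy μ rhat N hN) ≤
      3 * ((N : ℝ) * ε * Real.log (1 / ε) + EMdiv ((N : ℝ) / Real.log (1 / ε)) πstar μ) := by
  set L := Real.log (1 / ε) with hL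
  have hL1 : 1 ≤ L := by
    have := Real.log_le_log h0 h1
    rw [Real.log_exp] at this
    rw [hL, one_div, Real.log_inv]; linarith
  set M : ℝ := N / L with hM
  have hM0 : 0 ≤ M := by positivity
  have hMN : M ≤ N := div_le_self (by positivity) hL1
  have hN1 : (1:ℝ) ≤ N := by exact_mod_cast hN
  set β := bonPolicy μ rhat N hN with hβ
  have : IsProbabilityMeasure β :=
    Measure.isProbabilityMeasure_map (bon_meas rhat hh N hN).aemeasurable
  set f := Fr μ rstar with hf
  set g := Fr μ rhat with hg
  have hdiff : ∫ y, |g y - f y| ∂μ ≤ ε := he ▸ Fr_diff μ rhat rstar hh hs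
  have hdint : ∀ (ρ : Measure Y) [IsFiniteMeasure ρ], Integrable (fun y => |g y - f y|) ρ :=
    fun ρ _ => ((Fr_int μ rhat hh ρ).sub (Fr_int μ rstar hs ρ)).abs
  -- step 1
  have s1 : ∫ y, g y ∂β - ∫ y, f y ∂β ≤ N * ε := by
    rw [← integral_sub (Fr_int μ rhat hh β) (Fr_int μ rstar hs β)]
    calc ∫ y, (g y - f y) ∂β ≤ ∫ y, |g y - f y| ∂β :=
          integral_mono ((Fr_int μ rhat hh β).sub (Fr_int μ rstar hs β)) (hdint β)
            (fun y => le_abs_self _)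
      _ ≤ ∫ y, |g y - f y| ∂((N : ℝ≥0∞) • μ) :=
          integral_mono_measure (bon_le μ rhat hh N hN) (ae_of_all _ fun y => abs_nonneg _)
            ((hdint μ).smul_measure (by simp))
      _ = N * ∫ y, |g y - f y| ∂μ := by rw [integral_smul_measure]; simp
      _ ≤ N * ε := by gcongr
  -- densities
  set p : Y → ℝ := fun y => (πstar.rnDeriv μ y).toReal with hp
  have hpm : Measurable p := (Measure.measurable_rnDeriv _ _).ennreal_toReal
  have hp0 : ∀ y, 0 ≤ p y := fun y => toReal_nonneg
  have hpi : Integrable p μ := Measure.integrable_toReal_rnDeriv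
  set m : Y → ℝ := fun y => min (p y) M with hm
  have hmm : Measurable m := hpm.min measurable_const
  have hm0 : ∀ y, 0 ≤ m y := fun y => le_min (hp0 y) hM0
  have hmi : Integrable m μ := Integrable.of_mem_Icc 0 M hmm.aemeasurable
    (ae_of_all _ fun y => ⟨hm0 y, min_le_right _ _⟩)
  have hei : Integrable (fun y => max (p y - M) 0) μ := by
    have : (fun y => max (p y - M) 0) = fun y => p y - m y := by
      ext y; simp only [hm]; rcases le_total (p y) M with h | h <;> simp [h]
    rw [this]; exact hpi.sub hmi
  have hmul : ∀ (u : Y → ℝ), Integrable u μ → ∀ r : Y → ℝ, Measurable r →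
      Integrable (fun y => u y * Fr μ r y) μ := fun u hu r hr =>
    hu.mul_bdd (c := 1) (Fr_meas μ r hr).aestronglyMeasurable
      (ae_of_all _ fun y => by
        rw [Real.norm_eq_abs, abs_of_nonneg (Fr_nonneg μ r y)]; exact Fr_le_one μ r hr y)
  -- step 2
  have s2 : ∫ y, f y ∂πstar ≤ ∫ y, m y * g y ∂μ + M * ε + EMdiv M πstar μ := by
    rw [← integral_toReal_rnDeriv_mul hac]
    have hle : ∀ y, p y * f y ≤ m y * g y + M * |g y - f y| + max (p y - M) 0 := by
      intro y
      have e1 : p y = m y + max (p y - M) 0 := by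
        simp only [hm]; rcases le_total (p y) M with h | h <;> simp [h]
      have e2 : max (p y - M) 0 * f y ≤ max (p y - M) 0 :=
        mul_le_of_le_one_right (le_max_right _ _) (Fr_le_one μ rstar hs y)
      have e3 : m y * (f y - g y) ≤ M * |g y - f y| := by
        rw [abs_sub_comm]
        exact (mul_le_mul_of_nonneg_left (le_abs_self _) (hm0 y)).trans
          (mul_le_mul_of_nonneg_right (min_le_right _ _) (abs_nonneg _))
      calc p y * f y = m y * g y + m y * (f y - g y) + max (p y - M) 0 * f y := by
            nth_rewrite 1 [e1]; ring
        _ ≤ _ := by linarith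
    have i1 : Integrable (fun y => m y * g y) μ := hmul m hmi rhat hh
    have i2 : Integrable (fun y => M * |g y - f y|) μ := (hdint μ).const_mul M
    have := integral_mono (hmul p hpi rstar hs) ((i1.add i2).add hei) hle
    refine this.trans ?_
    rw [integral_add' (i1.add i2) hei, integral_add' i1 i2, integral_const_mul]
    have : M * ∫ y, |g y - f y| ∂μ ≤ M * ε := by gcongr
    unfold EMdiv
    linarith
  -- step 3
  have s3 : ∫ y, m y * g y ∂μ ≤ ∫ y, g y ∂β + ε := by
    set ν := μ.withDensity (fun y => ENNReal.ofReal (m y)) with hν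
    have hνf : IsFiniteMeasure ν := isFiniteMeasure_withDensity_ofReal hmi.2
    have hνi : ∫ y, m y * g y ∂μ = ∫ y, g y ∂ν := by
      rw [hν, integral_withDensity_eq_integral_toReal_smul hmm.ennreal_ofReal
        (ae_of_all _ fun y => ofReal_lt_top)]
      simp [ENNReal.toReal_ofReal (hm0 _)]
    have hνr : ∀ S, MeasurableSet S → ν.real S = ∫ y in S, m y ∂μ := by
      intro S hS
      rw [Measure.real, hν, withDensity_apply _ hS,
        integral_eq_lintegral_of_nonneg_ae (ae_of_all _ hm0) hmm.aestronglyMeasurable]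
    rw [hνi]
    refine layer ν β g (Fr_meas μ rhat hh) (Fr_nonneg μ rhat) (Fr_le_one μ rhat hh) ε fun t => ?_
    have hS : MeasurableSet {y | t ≤ g y} := measurableSet_le measurable_const (Fr_meas μ rhat hh)
    have ht := bon_tail μ rhat hh N hN t
    have hsc := scalar N ε L (μ.real {y | t ≤ g y}) (ν.real {y | t ≤ g y}) hL h0 hL1
      measureReal_nonneg measureReal_le_one ?_ ?_
    · linarith
    · rw [hνr _ hS]
      calc ∫ y in {y | t ≤ g y}, m y ∂μ ≤ ∫ y, m y ∂μ :=
            setIntegral_le_integral hmi (ae_of_all _ hm0)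
        _ ≤ ∫ y, p y ∂μ := integral_mono hmi hpi fun y => min_le_left _ _
        _ = 1 := by rw [hp, Measure.integral_toReal_rnDeriv hac]; simp
    · rw [hνr _ hS]
      calc ∫ y in {y | t ≤ g y}, m y ∂μ ≤ ∫ y in {y | t ≤ g y}, M ∂μ :=
            integral_mono hmi.integrableOn (integrable_const _) fun y => min_le_right _ _
        _ = _ := by simp [hM, mul_comm]
  have hE : 0 ≤ EMdiv M πstar μ := integral_nonneg fun y => le_max_right _ _
  have w1 : winRate μ rstar πstar = ∫ y, f y ∂πstar := rfl
  have w2 : winRate μ rstar β = ∫ y, f y ∂β := rfl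
  rw [w1, w2]
  have a1 : N * ε ≤ N * ε * L := le_mul_of_one_le_right (by positivity) hL1
  have a2 : M * ε ≤ N * ε := by gcongr
  have a3 : ε ≤ N * ε := le_mul_of_one_le_left h0.le hN1
  linarith

end Helpers


/-- **Best-of-N win-rate regret upper bound.** There is a universal constant `C > 0` such
that for any measurable space `Y`, probability reference measure `πref`, measurable rewards
`r⋆, r̂`, comparator `π⋆ ≪ πref`, and `N ≥ 1`, writing `ε = ε_pw(r̂)` and assuming
`0 < ε ≤ e⁻¹`, the Best-of-N policy satisfies
`R^{r⋆}(π⋆) − R^{r⋆}(π_BoN) ≤ C (N ε log(1/ε) + E_{N/log(1/ε)}(π⋆ ‖ πref))`. -/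
theorem stmt_0 :
    ∃ C : ℝ, 0 < C ∧
      ∀ (Y : Type) [MeasurableSpace Y]
        (πref : Measure Y) [IsProbabilityMeasure πref]
        (rstar rhat : Y → ℝ), Measurable rstar → Measurable rhat →
        ∀ (πstar : Measure Y) [IsProbabilityMeasure πstar], πstar ≪ πref →
        ∀ (N : ℕ) (hN : 0 < N) (ε : ℝ), ε = epw πref rhat rstar →
          0 < ε → ε ≤ Real.exp (-1) →
          winRate πref rstar πstar - winRate πref rstar (bonPolicy πref rhat N hN) ≤
            C * ((N : ℝ) * ε * Real.log (1 / ε) +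
              EMdiv ((N : ℝ) / Real.log (1 / ε)) πstar πref) := by
  refine ⟨3, by norm_num, ?_⟩
  intro Y _ πref _ rstar rhat hs hh πstar _ hac N hN ε he h0 h1
  exact main_bound πref rstar rhat hs hh πstar hac N hN ε he h0 h1
end
end

section
/- Let Y = [0,1] and let π_ref be the uniform distribution on [0,1]. Fix a real M ≥ 2, let I = [1 − 1/M, 1], let r⋆ = r̂ = 1_I (the indicator of I), and let π⋆ = π_ref(· | I), so that E_M(π⋆ ‖ π_ref) = 0. Let N ≥ 1 be an integer and let A : [0,1]^N × [0,1] → [0,1] be any measurable map satisfying A(y_1,…,y_N, u) ∈ {y_1,…,y_N} for all inputs; let π_A be the pushforward of π_ref^{⊗N} ⊗ Unif[0,1] under A. Then R^{r⋆}(π⋆) − R^{r⋆}(π_A) ≥ (1/2)·(1 − 1/M)^N. Consequently, if R^{r⋆}(π⋆) − R^{r⋆}(π_A) ≤ δ for some δ < 1/2, then N ≥ log(1/(2δ)) / log(M/(M−1)). -/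
open MeasureTheory ENNReal

noncomputable section

lemma phi_indicator_eq (I : Set ℝ) (y y' : ℝ) :
    phi (I.indicator (1 : ℝ → ℝ)) y y' =
      1 / 2 + 1 / 2 * I.indicator (1 : ℝ → ℝ) y - 1 / 2 * I.indicator (1 : ℝ → ℝ) y' := by
  unfold phi
  by_cases h : y ∈ I <;> by_cases h' : y' ∈ I <;> simp [h, h'] <;> norm_num

lemma winRate_indicator_eq (q π : Measure ℝ) [IsProbabilityMeasure q] [IsProbabilityMeasure π]
    (I : Set ℝ) (hI : MeasurableSet I) :
    winRate q (I.indicator (1 : ℝ → ℝ)) π = 1 / 2 - 1 / 2 * q.real I + 1 / 2 * π.real I := by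
  have hint : ∀ μ : Measure ℝ, IsProbabilityMeasure μ →
      Integrable (fun y => 1 / 2 * I.indicator (1 : ℝ → ℝ) y) μ := by
    intro μ _
    exact ((integrable_const (1 : ℝ)).indicator hI).const_mul _
  have h1 : ∀ μ : Measure ℝ, ∫ y, I.indicator (1 : ℝ → ℝ) y ∂μ = μ.real I := by
    intro μ
    exact integral_indicator_one hI
  unfold winRate winRateQ
  have h2 : ∀ y, ∫ y', phi (I.indicator (1 : ℝ → ℝ)) y y' ∂q =
      (1 / 2 - 1 / 2 * q.real I) + 1 / 2 * I.indicator (1 : ℝ → ℝ) y := by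
    intro y
    simp_rw [phi_indicator_eq]
    rw [integral_sub (integrable_const _) (hint q inferInstance), integral_const_mul, h1]
    simp
    ring
  simp_rw [h2]
  rw [integral_add (integrable_const _) (hint π inferInstance), integral_const_mul, h1]
  simp

/-- **Computational lower bound for hitting the top set.** With `Y = [0,1]`, `πref` uniform,
`M ≥ 2`, `I = [1 − 1/M, 1]`, `r⋆ = r̂ = 1_I`, and `π⋆ = πref(·|I)` (so `E_M(π⋆‖πref) = 0`),
any measurable selection rule `A` choosing one of its `N` inputs has win-rate regret at least
`(1/2)(1 − 1/M)^N`; hence regret `≤ δ < 1/2` forces `N ≥ log(1/(2δ))/log(M/(M−1))`. -/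
theorem stmt_2 (M : ℝ) (hM : 2 ≤ M) (N : ℕ) (hN : 1 ≤ N)
    (A : (Fin N → ℝ) × ℝ → ℝ) (hAmeas : Measurable A)
    (hAsel : ∀ (ys : Fin N → ℝ) (u : ℝ), ∃ i, A (ys, u) = ys i) :
    let πref : Measure ℝ := volume.restrict (Set.Icc 0 1)
    let I : Set ℝ := Set.Icc (1 - 1 / M) 1
    let rstar : ℝ → ℝ := I.indicator 1
    let πstar : Measure ℝ := (πref I)⁻¹ • πref.restrict I
    let πA : Measure ℝ := Measure.map A ((Measure.pi fun _ : Fin N => πref).prod πref)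
    EMdiv M πstar πref = 0 ∧
    winRate πref rstar πstar - winRate πref rstar πA ≥ (1 / 2) * (1 - 1 / M) ^ N ∧
    ∀ δ : ℝ, δ < 1 / 2 → winRate πref rstar πstar - winRate πref rstar πA ≤ δ →
      (N : ℝ) ≥ Real.log (1 / (2 * δ)) / Real.log (M / (M - 1)) := by
  intro πref I rstar πstar πA
  have hM0 : 0 < M := by linarith
  have hMi : 1 / M ≤ 1 / 2 := one_div_le_one_div_of_le (by norm_num) hM
  have hMp : 0 < 1 / M := by positivity
  have hI : MeasurableSet I := measurableSet_Icc
  haveI : IsProbabilityMeasure πref := ⟨by simp [πref]⟩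
  have hrefI : πref I = ENNReal.ofReal (1 / M) := by
    have : I ⊆ Set.Icc 0 1 := Set.Icc_subset_Icc (by linarith) le_rfl
    simp only [πref]
    rw [Measure.restrict_apply hI, Set.inter_eq_left.mpr this]
    simp [I]
  have hI0 : πref I ≠ 0 := by rw [hrefI]; simpa using hM0
  have hIt : πref I ≠ ∞ := measure_ne_top _ _
  have hIr : πref.real I = 1 / M := by
    rw [Measure.real, hrefI, ENNReal.toReal_ofReal hMp.le]
  haveI : IsProbabilityMeasure πstar := ⟨by
    simp only [πstar, Measure.smul_apply, Measure.restrict_apply_univ, smul_eq_mul]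
    exact ENNReal.inv_mul_cancel hI0 hIt⟩
  have hstarI : πstar.real I = 1 := by
    have : πstar I = 1 := by
      simp only [πstar, Measure.smul_apply, Measure.restrict_apply_self, smul_eq_mul]
      exact ENNReal.inv_mul_cancel hI0 hIt
    simp [Measure.real, this]
  haveI : IsProbabilityMeasure πA := Measure.isProbabilityMeasure_map hAmeas.aemeasurable
  have hAI : (1 - 1 / M) ^ N ≤ πA.real Iᶜ := by
    have hsub : (Set.univ.pi fun _ : Fin N => Iᶜ) ×ˢ (Set.univ : Set ℝ) ⊆ A ⁻¹' Iᶜ := by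
      rintro ⟨ys, u⟩ ⟨h, -⟩
      obtain ⟨i, hi⟩ := hAsel ys u
      show A (ys, u) ∈ Iᶜ
      rw [hi]
      exact h i (Set.mem_univ i)
    have hc : πref.real Iᶜ = 1 - 1 / M := by
      rw [probReal_compl_eq_one_sub hI, hIr]
    simp only [πA]
    rw [map_measureReal_apply hAmeas hI.compl]
    refine le_trans (le_of_eq ?_) (measureReal_mono hsub)
    rw [Measure.real, Measure.prod_prod, Measure.pi_pi]
    simp [ENNReal.toReal_mul, ← Measure.real_def, hc]
  have hreg : winRate πref rstar πstar - winRate πref rstar πA ≥ (1 / 2) * (1 - 1 / M) ^ N := by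
    simp only [rstar]
    rw [winRate_indicator_eq _ _ I hI, winRate_indicator_eq _ _ I hI, hstarI]
    rw [probReal_compl_eq_one_sub hI] at hAI
    linarith
  refine ⟨?_, hreg, ?_⟩
  · have hd : πstar.rnDeriv πref =ᵐ[πref] fun y => (πref I)⁻¹ * I.indicator 1 y := by
      have e1 := Measure.rnDeriv_smul_left_of_ne_top (πref.restrict I) πref
        (r := (πref I)⁻¹) (ENNReal.inv_ne_top.mpr hI0)
      have e2 := Measure.rnDeriv_restrict_self πref hI
      filter_upwards [e1, e2] with y h1 h2
      rw [h1, Pi.smul_apply, h2, smul_eq_mul]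
    unfold EMdiv
    apply integral_eq_zero_of_ae
    filter_upwards [hd] with y hy
    rw [hy, hrefI]
    by_cases h : y ∈ I
    · simp [h, ENNReal.toReal_inv, hM0.le]
    · simp [h, hM0.le]
  · intro δ hδ hle
    have hq : 0 < 1 - 1 / M := by linarith
    have hqN : 0 < (1 - 1 / M) ^ N := pow_pos hq N
    have h2 : (1 - 1 / M) ^ N ≤ 2 * δ := by linarith
    have hδ0 : 0 < 2 * δ := by linarith
    have hM1 : 0 < M - 1 := by linarith
    have hlog : 0 < Real.log (M / (M - 1)) := by
      apply Real.log_pos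
      rw [lt_div_iff₀ hM1]; linarith
    have heq : M / (M - 1) = (1 - 1 / M)⁻¹ := by
      field_simp
    rw [ge_iff_le, div_le_iff₀ hlog, heq, Real.log_inv, one_div (2 * δ), Real.log_inv]
    have := Real.log_le_log hqN h2
    rw [Real.log_pow] at this
    linarith
end
end

section
/- Let Y be a measurable space, π_ref a probability measure on Y, R_max > 0, r̂ : Y → [0, R_max] measurable, and M ≥ 1 a real number, and suppose λ ∈ ℝ satisfies π_ref({y : r̂(y) ≥ λ}) = 1/M. Let π_M = π_ref(· | r̂(·) ≥ λ). Then E_M(π_M ‖ π_ref) = 0, and for every probability measure π on Y with π ≪ π_ref, ∫ r̂ dπ − R_max·E_M(π ‖ π_ref) ≤ ∫ r̂ dπ_M; that is, the top-(1/M)-quantile policy π_M maximizes the E_M-regularized objective π ↦ ∫ r̂ dπ − R_max·E_M(π ‖ π_ref) over all probability measures π ≪ π_ref. -/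
open MeasureTheory ENNReal

noncomputable section

/-- **The top-`1/M`-quantile policy solves the `E_M`-regularized variational problem.**
If `πref({r̂ ≥ λ}) = 1/M`, then `π_M = πref(·| r̂ ≥ λ)` has `E_M(π_M ‖ πref) = 0` and
maximizes `π ↦ ∫ r̂ dπ − R_max · E_M(π ‖ πref)` over all `π ≪ πref`. -/
theorem stmt_3 {Y : Type*} [MeasurableSpace Y]
    (πref : Measure Y) [IsProbabilityMeasure πref]
    (Rmax : ℝ) (hR : 0 < Rmax)
    (rhat : Y → ℝ) (hmeas : Measurable rhat) (hbd : ∀ y, rhat y ∈ Set.Icc 0 Rmax)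
    (M : ℝ) (hM : 1 ≤ M) (lam : ℝ)
    (hlam : πref {y | lam ≤ rhat y} = ENNReal.ofReal (1 / M)) :
    let πM : Measure Y := (πref {y | lam ≤ rhat y})⁻¹ • πref.restrict {y | lam ≤ rhat y}
    EMdiv M πM πref = 0 ∧
    ∀ π : Measure Y, IsProbabilityMeasure π → π ≪ πref →
      ∫ y, rhat y ∂π - Rmax * EMdiv M π πref ≤ ∫ y, rhat y ∂πM := by
  intro πM
  have hM0 : 0 < M := by linarith
  have hA : MeasurableSet {y | lam ≤ rhat y} := measurableSet_le measurable_const hmeas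
  have hinv : (πref {y | lam ≤ rhat y})⁻¹ = ENNReal.ofReal M := by
    rw [hlam, ← ENNReal.ofReal_inv_of_pos (by positivity)]
    simp
  have hreal : πref.real {y | lam ≤ rhat y} = 1 / M := by
    rw [Measure.real, hlam, ENNReal.toReal_ofReal (by positivity)]
  have hπM : πM = ENNReal.ofReal M • πref.restrict {y | lam ≤ rhat y} := by
    simp only [πM, hinv]
  clear_value πM
  subst hπM
  set A := {y | lam ≤ rhat y} with hAdef
  constructor
  · unfold EMdiv
    have h1 : (ENNReal.ofReal M • πref.restrict A).rnDeriv πref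
        =ᵐ[πref] A.indicator (fun _ => ENNReal.ofReal M) := by
      have h2 : ENNReal.ofReal M • πref.restrict A
          = πref.withDensity (A.indicator (fun _ => ENNReal.ofReal M)) := by
        rw [withDensity_indicator hA, withDensity_const]
      rw [h2]
      exact Measure.rnDeriv_withDensity πref (measurable_const.indicator hA)
    apply integral_eq_zero_of_ae
    filter_upwards [h1] with y hy
    rw [hy]
    by_cases h : y ∈ A
    · simp [h, hM0.le]
    · simp [h, hM0.le]
  · intro π hπ hac
    unfold EMdiv
    set f : Y → ℝ := fun y => (π.rnDeriv πref y).toReal with hf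
    have hfi : Integrable f πref := Measure.integrable_toReal_rnDeriv
    have hf1 : ∫ y, f y ∂πref = 1 := by
      rw [hf, Measure.integral_toReal_rnDeriv hac]
      simp
    have hri : ∀ μ : Measure Y, IsFiniteMeasure μ → Integrable rhat μ := by
      intro μ _
      refine Integrable.of_bound hmeas.aestronglyMeasurable Rmax (ae_of_all _ fun y => ?_)
      rw [Real.norm_eq_abs, abs_of_nonneg (hbd y).1]
      exact (hbd y).2
    have hrπ : ∫ y, rhat y ∂π = ∫ y, f y * rhat y ∂πref := by
      rw [← integral_rnDeriv_smul hac]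
      simp [hf]
    have hfr : Integrable (fun y => f y * rhat y) πref := by
      have := (integrable_rnDeriv_smul_iff hac (f := rhat)).2 (hri π inferInstance)
      simpa [hf] using this
    have hmx : Integrable (fun y => max (f y - M) 0) πref :=
      (hfi.sub (integrable_const M)).pos_part
    have hrM : ∫ y, rhat y ∂(ENNReal.ofReal M • πref.restrict A)
        = M * ∫ y, A.indicator rhat y ∂πref := by
      rw [integral_smul_measure, integral_indicator hA, ENNReal.toReal_ofReal hM0.le, smul_eq_mul]
    have hAr : Integrable (A.indicator rhat) πref := (hri πref inferInstance).indicator hA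
    have hA1 : Integrable (A.indicator (fun _ => (1 : ℝ))) πref :=
      (integrable_const (1 : ℝ)).indicator hA
    have hA1v : ∫ y, A.indicator (fun _ => (1 : ℝ)) y ∂πref = 1 / M := by
      rw [integral_indicator hA]
      simp [hreal]
    set L := max lam 0 with hL
    have hL0 : 0 ≤ L := le_max_right _ _
    have hLl : lam ≤ L := le_max_left _ _
    have key : ∫ y, f y * rhat y ∂πref ≤
        ∫ y, (Rmax * max (f y - M) 0 + M * A.indicator rhat y) +
          L * (f y - M * A.indicator (fun _ => (1 : ℝ)) y) ∂πref := by
      refine integral_mono hfr (((hmx.const_mul _).add (hAr.const_mul _)).add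
        ((hfi.sub (hA1.const_mul _)).const_mul _)) fun y => ?_
      have hf0 : 0 ≤ f y := ENNReal.toReal_nonneg
      obtain ⟨h0, h1⟩ := hbd y
      have m1 := le_max_left (f y - M) 0
      have m0 := le_max_right (f y - M) 0
      by_cases h : y ∈ A
      · simp only [Set.indicator_of_mem h]
        have hrL : L ≤ rhat y := max_le h h0
        nlinarith [mul_le_mul_of_nonneg_left m1 (sub_nonneg.2 hrL),
          mul_nonneg (by linarith : 0 ≤ Rmax - rhat y + L) m0]
      · simp only [Set.indicator_of_notMem h]
        have hrL : rhat y ≤ L := (not_le.1 h).le.trans hLl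
        nlinarith [mul_nonneg hf0 (sub_nonneg.2 hrL), mul_nonneg hR.le m0]
    have i1 : Integrable (fun y => Rmax * max (f y - M) 0 + M * A.indicator rhat y) πref :=
      (hmx.const_mul _).add (hAr.const_mul _)
    have i2 : Integrable (fun y => L * (f y - M * A.indicator (fun _ => (1 : ℝ)) y)) πref :=
      (hfi.sub (hA1.const_mul _)).const_mul _
    rw [integral_add i1 i2,
      integral_add (hmx.const_mul _) (hAr.const_mul _), integral_const_mul, integral_const_mul,
      integral_const_mul, integral_sub hfi (hA1.const_mul _), integral_const_mul, hf1, hA1v,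
      mul_one_div_cancel hM0.ne'] at key
    rw [hrπ, hrM]
    linarith
end
end

section
/- Fix reals c > 1, k ≥ √(2c), δ ∈ [1 − 1/(2c), 1), and ε ∈ (0, 1/(4k²)], and set α = k√ε. Let Y = {B, C, P} be a three-point set, and let π_ref be the probability measure with π_ref({B}) = 1 − α, π_ref({C}) = α − ε, π_ref({P}) = ε. Define r̂(B) = 0, r̂(C) = 1 − δ, r̂(P) = 1, and r⋆(B) = 1/2, r⋆(C) = 1, r⋆(P) = 0. Let π_EM = π_ref(· | {C, P}) and define the win-rate regret Reg(π) = R^{r⋆}(δ_C) − R^{r⋆}(π), where δ_C is the point mass at C. Then: (i) ε_pw(r̂) = 2ε(1 − ε); and (ii) for every β > 0 and every λ ∈ ℝ satisfying ∫ max(r̂(y) − λ, 0) dπ_ref(y) = β, the χ²-regularized policy π^χ_β defined by π^χ_β({y}) = π_ref({y})·max(r̂(y) − λ, 0)/β is a probability measure and satisfies Reg(π^χ_β) ≥ c·Reg(π_EM). -/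
open MeasureTheory ENNReal

noncomputable section

lemma mu_real (a b d : ℝ) (y : Fin 3) :
    (ENNReal.ofReal a • Measure.dirac (0 : Fin 3) + ENNReal.ofReal b • Measure.dirac 1 +
      ENNReal.ofReal d • Measure.dirac 2 : Measure (Fin 3)) {y} = ENNReal.ofReal (![a, b, d] y) := by
  fin_cases y <;> simp

lemma mu_int (a b d : ℝ) (ha : 0 ≤ a) (hb : 0 ≤ b) (hd : 0 ≤ d) (f : Fin 3 → ℝ) :
    ∫ y, f y ∂(ENNReal.ofReal a • Measure.dirac (0 : Fin 3) + ENNReal.ofReal b • Measure.dirac 1 +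
      ENNReal.ofReal d • Measure.dirac 2) = a * f 0 + b * f 1 + d * f 2 := by
  have h (x : ℝ) (y : Fin 3) : IsFiniteMeasure (ENNReal.ofReal x • Measure.dirac y) :=
    Measure.smul_finite _ ENNReal.ofReal_ne_top
  rw [integral_fintype .of_finite]
  simp [Fin.sum_univ_three, Measure.real, mu_real a b d, ha, hb, hd,
    -Measure.coe_add, -Measure.coe_smul]

lemma key (c k δ ε α : ℝ) (hc : 1 < c) (hk0 : 0 < k) (hk2 : 2 * c ≤ k ^ 2)
    (hδ1 : c * (1 - δ) ≤ 1 / 2) (hδ2 : δ < 1) (hε0 : 0 < ε) (hα0 : 0 < α)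
    (hα : α ^ 2 = k ^ 2 * ε) (hα2 : α ≤ 1 / 2) (hε8 : ε ≤ 1 / 8) (β lam : ℝ) (hβ : 0 < β)
    (h : (1 - α) * max (0 - lam) 0 + (α - ε) * max (1 - δ - lam) 0 + ε * max (1 - lam) 0 = β)
    (hαε : ε ≤ α) :
    c * (ε / α * (1 - α / 2)) ≤ (1 - α) * (max (0 - lam) 0 / β) * ((1 - ε) / 2) +
      ε * (max (1 - lam) 0 / β) * (1 - α / 2) := by
  have h2 : 2 * c * ε ≤ α ^ 2 := by rw [hα]; gcongr
  have hcs : c * ((α - ε) * (1 - δ) + ε) ≤ α := by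
    nlinarith [mul_le_mul_of_nonneg_left hδ1 (sub_nonneg.2 hαε)]
  have hg : 0 < 1 - α / 2 := by linarith
  have hδ0 : 0 < δ := by nlinarith
  have e : (1 - α) * (max (0 - lam) 0 / β) * ((1 - ε) / 2) +
      ε * (max (1 - lam) 0 / β) * (1 - α / 2) =
      ((1 - α) * max (0 - lam) 0 * ((1 - ε) / 2) + ε * max (1 - lam) 0 * (1 - α / 2)) / β := by
    ring
  have e' : c * (ε / α * (1 - α / 2)) = c * ε * (1 - α / 2) / α := by ring
  rw [e, e', div_le_div_iff₀ hα0 hβ]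
  rcases le_or_gt 0 lam with hl | hl
  · rw [max_eq_right (by linarith : 0 - lam ≤ 0)] at h ⊢
    have hm1 : 0 ≤ max (1 - lam) 0 := le_max_right _ _
    have hm : max (1 - δ - lam) 0 ≤ (1 - δ) * max (1 - lam) 0 := by
      apply max_le
      · nlinarith [le_max_left (1 - lam) 0, mul_nonneg hδ0.le hl]
      · exact mul_nonneg (by linarith) hm1
    have hb : β ≤ ((α - ε) * (1 - δ) + ε) * max (1 - lam) 0 := by
      nlinarith [mul_le_mul_of_nonneg_left hm (sub_nonneg.2 hαε)]
    have : c * β ≤ α * max (1 - lam) 0 := by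
      nlinarith [mul_le_mul_of_nonneg_right hcs hm1]
    nlinarith [mul_le_mul_of_nonneg_left this (mul_pos hε0 hg).le]
  · rw [max_eq_left (by linarith : 0 ≤ 0 - lam), max_eq_left (by linarith : 0 ≤ 1 - lam)] at *
    rw [max_eq_left (by linarith : 0 ≤ 1 - δ - lam)] at h
    obtain ⟨t, rfl⟩ : ∃ t, lam = -t := ⟨-lam, by ring⟩
    have ht : 0 < t := by linarith
    have hb : β = t + ((α - ε) * (1 - δ) + ε) := by rw [← h]; ring
    have h1 : c * ε * (1 - α / 2) ≤ (1 - α) * ((1 - ε) / 2) * α := by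
      have h3 : α * (1 - α / 2) ≤ (1 - α) * (1 - ε) := by nlinarith
      nlinarith [mul_le_mul_of_nonneg_left h3 hα0.le, mul_le_mul_of_nonneg_right h2 hg.le]
    have h4 := mul_le_mul_of_nonneg_left hcs (mul_pos hε0 hg).le
    have h5 := mul_le_mul_of_nonneg_left h1 ht.le
    have h6 : 0 ≤ ε * t * (1 - α / 2) * α := by positivity
    rw [hb]
    nlinarith

/-- **Separation between `χ²`-regularized BoN and `E_M`-regularized BoN.** On the
three-point hard instance `Y = {B, C, P}` (encoded as `Fin 3` with `B = 0`, `C = 1`,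
`P = 2`), the pairwise error equals `2ε(1−ε)` and, for every `β > 0` and normalizing
threshold `λ`, the `χ²`-regularized policy is a probability measure whose win-rate regret
is at least `c` times that of the top-quantile policy `π_EM = πref(·|{C,P})`. -/
theorem stmt_5 (c k δ ε : ℝ) (hc : 1 < c) (hk : Real.sqrt (2 * c) ≤ k)
    (hδ1 : 1 - 1 / (2 * c) ≤ δ) (hδ2 : δ < 1) (hε0 : 0 < ε) (hε : ε ≤ 1 / (4 * k ^ 2)) :
    let α : ℝ := k * Real.sqrt ε
    let πref : Measure (Fin 3) :=
      ENNReal.ofReal (1 - α) • Measure.dirac 0 +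
        ENNReal.ofReal (α - ε) • Measure.dirac 1 +
        ENNReal.ofReal ε • Measure.dirac 2
    let rhat : Fin 3 → ℝ := ![0, 1 - δ, 1]
    let rstar : Fin 3 → ℝ := ![1 / 2, 1, 0]
    let πEM : Measure (Fin 3) :=
      (πref ({1, 2} : Set (Fin 3)))⁻¹ • πref.restrict ({1, 2} : Set (Fin 3))
    epw πref rhat rstar = 2 * ε * (1 - ε) ∧
    ∀ β lam : ℝ, 0 < β → (∫ y, max (rhat y - lam) 0 ∂πref) = β →
      let πchi : Measure (Fin 3) :=
        ∑ y : Fin 3, (πref {y} * ENNReal.ofReal (max (rhat y - lam) 0 / β)) • Measure.dirac y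
      IsProbabilityMeasure πchi ∧
      winRate πref rstar (Measure.dirac 1) - winRate πref rstar πchi ≥
        c * (winRate πref rstar (Measure.dirac 1) - winRate πref rstar πEM) := by
  intro α πref rhat rstar πEM
  have h2c : 0 < Real.sqrt (2 * c) := Real.sqrt_pos.2 (by linarith)
  have hk0 : 0 < k := by linarith
  have hk2 : 2 * c ≤ k ^ 2 := by
    rw [← Real.sq_sqrt (by linarith : 0 ≤ 2 * c)]; gcongr
  have hα0 : 0 < α := mul_pos hk0 (Real.sqrt_pos.2 hε0)
  have hα : α ^ 2 = k ^ 2 * ε := by simp only [α]; rw [mul_pow, Real.sq_sqrt hε0.le]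
  have hke : k ^ 2 * ε ≤ 1 / 4 := by
    rw [le_div_iff₀ (by positivity)] at hε; linarith
  have hα2 : α ≤ 1 / 2 := by nlinarith
  have hε8 : ε ≤ 1 / 8 := by nlinarith
  have hαε : ε ≤ α := by nlinarith
  have hδ' : c * (1 - δ) ≤ 1 / 2 := by
    have : 1 - δ ≤ 1 / (2 * c) := by linarith
    rw [le_div_iff₀ (by linarith)] at this; linarith
  have hδ0 : 0 < δ := by nlinarith
  have hI : ∀ f : Fin 3 → ℝ, ∫ y, f y ∂πref = (1 - α) * f 0 + (α - ε) * f 1 + ε * f 2 :=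
    mu_int _ _ _ (by linarith) (by linarith) hε0.le
  have hM : ∀ y, πref {y} = ENNReal.ofReal (![1 - α, α - ε, ε] y) :=
    mu_real _ _ _
  have hEM : πEM = ENNReal.ofReal 0 • Measure.dirac 0 +
      ENNReal.ofReal ((α - ε) / α) • Measure.dirac 1 +
      ENNReal.ofReal (ε / α) • Measure.dirac 2 := by
    have h12 : πref ({1, 2} : Set (Fin 3)) = ENNReal.ofReal α := by
      rw [show ({1, 2} : Set (Fin 3)) = {1} ∪ {2} from rfl,
        measure_union (by simp) (by simp), hM, hM, ← ENNReal.ofReal_add]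
      · simp
      · simp; linarith
      · simp; linarith
    apply Measure.ext_of_singleton
    intro y
    rw [mu_real]
    simp only [πEM, Measure.smul_apply, smul_eq_mul, h12]
    rw [Measure.restrict_apply (by simp), ← ENNReal.ofReal_inv_of_pos hα0]
    have e0 : ({0} ∩ {1, 2} : Set (Fin 3)) = ∅ := by ext x; fin_cases x <;> simp
    have e1 : ({1} ∩ {1, 2} : Set (Fin 3)) = {1} := by ext x; fin_cases x <;> simp
    have e2 : ({2} ∩ {1, 2} : Set (Fin 3)) = {2} := by ext x; fin_cases x <;> simp
    have hi : 0 ≤ α⁻¹ := by positivity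
    fin_cases y
    · simp [e0]
    · simp [e1, hM, ← ENNReal.ofReal_mul hi, div_eq_inv_mul]
    · simp [e2, hM, ← ENNReal.ofReal_mul hi, div_eq_inv_mul]
  have r0 : rstar 0 = 1 / 2 := rfl
  have r1 : rstar 1 = 1 := rfl
  have r2 : rstar 2 = 0 := rfl
  have s0 : rhat 0 = 0 := rfl
  have s1 : rhat 1 = 1 - δ := rfl
  have s2 : rhat 2 = 1 := rfl
  have i0 : ∫ y', phi rstar 0 y' ∂πref = ε + (1 - α) / 2 := by
    rw [hI]; simp only [phi, r0, r1, r2]; norm_num; ring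
  have i1 : ∫ y', phi rstar 1 y' ∂πref = ε + (1 - α) + (α - ε) / 2 := by
    rw [hI]; simp only [phi, r0, r1, r2]; norm_num; ring
  have i2 : ∫ y', phi rstar 2 y' ∂πref = ε / 2 := by
    rw [hI]; simp only [phi, r0, r1, r2]; norm_num; ring
  refine ⟨?_, ?_⟩
  · have d1 : (0:ℝ) < 1 - δ := by linarith
    have d2 : 1 - δ < 1 := by linarith
    simp only [epw, hI, phi, r0, r1, r2, s0, s1, s2, d1, d2, d1.not_gt, d2.not_gt, d1.ne, d1.ne',
      d2.ne, d2.ne', if_true, if_false, lt_irrefl]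
    norm_num
    ring
  intro β lam hβ hβe πchi
  rw [hI, s0, s1, s2] at hβe
  have n0 : 0 ≤ max (0 - lam) 0 / β := div_nonneg (le_max_right _ _) hβ.le
  have n1 : 0 ≤ max (1 - δ - lam) 0 / β := div_nonneg (le_max_right _ _) hβ.le
  have n2 : 0 ≤ max (1 - lam) 0 / β := div_nonneg (le_max_right _ _) hβ.le
  have p0 : 0 ≤ (1 - α) * (max (0 - lam) 0 / β) := mul_nonneg (by linarith) n0
  have p1 : 0 ≤ (α - ε) * (max (1 - δ - lam) 0 / β) := mul_nonneg (by linarith) n1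
  have p2 : 0 ≤ ε * (max (1 - lam) 0 / β) := mul_nonneg (by linarith) n2
  have hsum : (1 - α) * (max (0 - lam) 0 / β) + (α - ε) * (max (1 - δ - lam) 0 / β) +
      ε * (max (1 - lam) 0 / β) = 1 := by
    have := congrArg (· / β) hβe
    simp only [div_self hβ.ne'] at this
    refine Eq.trans ?_ this; ring
  have hchi : πchi = ENNReal.ofReal ((1 - α) * (max (0 - lam) 0 / β)) • Measure.dirac 0 +
      ENNReal.ofReal ((α - ε) * (max (1 - δ - lam) 0 / β)) • Measure.dirac 1 +
      ENNReal.ofReal (ε * (max (1 - lam) 0 / β)) • Measure.dirac 2 := by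
    simp only [πchi, Fin.sum_univ_three, hM, s0, s1, s2]
    rw [ENNReal.ofReal_mul (by linarith), ENNReal.ofReal_mul (by linarith),
      ENNReal.ofReal_mul (by linarith)]
    rfl
  constructor
  · rw [hchi]
    constructor
    simp only [Measure.add_apply, Measure.smul_apply, measure_univ, smul_eq_mul, mul_one]
    rw [← ENNReal.ofReal_add p0 p1, ← ENNReal.ofReal_add (by linarith) p2, hsum, ENNReal.ofReal_one]
  · have hk := key c k δ ε α hc hk0 hk2 hδ' hδ2 hε0 hα0 hα hα2 hε8 β lam hβ hβe hαε
    rw [hchi, hEM]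
    simp only [winRate, winRateQ, integral_dirac]
    rw [mu_int _ _ _ p0 p1 p2, mu_int _ _ _ le_rfl (div_nonneg (by linarith) hα0.le) (by positivity),
      i0, i1, i2]
    have hd : (α - ε) / α = 1 - ε / α := by field_simp
    rw [hd, ge_iff_le]
    have hq : (α - ε) * (max (1 - δ - lam) 0 / β) = 1 - (1 - α) * (max (0 - lam) 0 / β) -
      ε * (max (1 - lam) 0 / β) := by linarith
    rw [hq]
    convert hk using 1 <;> ring
end
end

section
/- There is a universal constant C > 0 with the following property. Let Y be a measurable space, π_ref and q probability measures on Y with q ≪ π_ref and dq/dπ_ref ≤ L π_ref-almost everywhere for some L ≥ 1. Let r⋆, r̂ : Y → ℝ be measurable reward functions, π⋆ a probability measure with π⋆ ≪ π_ref, M ≥ 1 a real, and N ≥ 1 an integer. Then the empirical E_M-regularized Best-of-N policy π̂_M satisfies R_q^{r⋆}(π⋆) − R_q^{r⋆}(π̂_M) ≤ C·( L·E_M(π⋆ ‖ π_ref) + L·M·ε_pw(r̂) + √(M/N) ). -/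
open MeasureTheory ENNReal

noncomputable section

section Aux

open ProbabilityTheory

variable {Y : Type*} [MeasurableSpace Y]

lemma aux_card_lt (rhat : Y → ℝ) {N : ℕ} (ys : Fin N → Y) (vs : Fin N → ℝ) (i j : Fin N)
    (h : j ∈ lexAbove rhat ys vs i) :
    (lexAbove rhat ys vs j).card < (lexAbove rhat ys vs i).card := by
  apply Finset.card_lt_card
  rw [Finset.ssubset_iff_of_subset]
  · exact ⟨j, h, by simp [lexAbove]⟩
  · intro l hl
    simp only [lexAbove, Finset.mem_filter, Finset.mem_univ, true_and] at h hl ⊢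
    rcases h with h | ⟨h, h' | ⟨h', h''⟩⟩ <;> rcases hl with hl | ⟨hl, hl' | ⟨hl', hl''⟩⟩
    · left; linarith
    · left; linarith
    · left; linarith
    · left; linarith
    · right; exact ⟨by linarith, Or.inl (by linarith)⟩
    · right; exact ⟨by linarith, Or.inl (by linarith)⟩
    · left; linarith
    · right; exact ⟨by linarith, Or.inl (by linarith)⟩
    · right; exact ⟨by linarith, Or.inr ⟨by linarith, hl''.trans h''⟩⟩

lemma aux_total (rhat : Y → ℝ) {N : ℕ} (ys : Fin N → Y) (vs : Fin N → ℝ) (i j : Fin N)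
    (h : i ≠ j) : j ∈ lexAbove rhat ys vs i ∨ i ∈ lexAbove rhat ys vs j := by
  simp only [lexAbove, Finset.mem_filter, Finset.mem_univ, true_and]
  rcases lt_trichotomy (rhat (ys i)) (rhat (ys j)) with h1 | h1 | h1
  · tauto
  · rcases lt_trichotomy (vs i) (vs j) with h2 | h2 | h2
    · tauto
    · rcases lt_or_gt_of_ne h with h3 | h3
      · right; right; exact ⟨h1.symm, Or.inr ⟨h2.symm, h3⟩⟩
      · left; right; exact ⟨h1, Or.inr ⟨h2, h3⟩⟩
    · right; right; exact ⟨h1.symm, Or.inl h2⟩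
  · tauto

lemma aux_card_top (rhat : Y → ℝ) {N : ℕ} (ys : Fin N → Y) (vs : Fin N → ℝ) (k : ℕ)
    (hk : k ≤ N) :
    (Finset.univ.filter fun i => (lexAbove rhat ys vs i).card < k).card = k := by
  have hlt : ∀ i, (lexAbove rhat ys vs i).card < N := by
    intro i
    have : (lexAbove rhat ys vs i).card < (Finset.univ : Finset (Fin N)).card := by
      apply Finset.card_lt_card
      rw [Finset.ssubset_iff_of_subset (Finset.subset_univ _)]
      exact ⟨i, Finset.mem_univ _, by simp [lexAbove]⟩
    simpa using this
  let f : Fin N → Fin N := fun i => ⟨_, hlt i⟩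
  have hinj : Function.Injective f := by
    intro i j hij
    by_contra hne
    have h := congrArg Fin.val hij
    simp only [f] at h
    rcases aux_total rhat ys vs i j hne with h1 | h1
    · have := aux_card_lt rhat ys vs _ _ h1; omega
    · have := aux_card_lt rhat ys vs _ _ h1; omega
  have hbij : Function.Bijective f := Finite.injective_iff_bijective.mp hinj
  have : (Finset.univ.filter fun i => (lexAbove rhat ys vs i).card < k).card =
      (Finset.univ.filter fun i : Fin N => (i : ℕ) < k).card := by
    apply Finset.card_bijective f hbij
    intro i
    simp [f]
  rw [this, Fin.card_filter_val_lt]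
  omega

/-- Deterministic top-k inequality. -/
lemma aux_det {N : ℕ} (S : Finset (Fin N)) (k : ℕ) (hk : 0 < k) (hS : S.card = k)
    (w G : Fin N → ℝ) (b : ℝ) (hw0 : ∀ i, 0 ≤ w i) (hwb : ∀ i, w i ≤ b)
    (hkb : 1 ≤ k * b) (hkb' : k * b ≤ 1 + b)
    (hG0 : ∀ i, 0 ≤ G i) (hG1 : ∀ i, G i ≤ 1)
    (hmon : ∀ i ∈ S, ∀ j ∉ S, G j ≤ G i) :
    ∑ i, w i * G i - (k : ℝ)⁻¹ * ∑ i ∈ S, G i ≤ max (∑ i, w i - 1) 0 + b := by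
  have hne : S.Nonempty := by rw [← Finset.card_pos]; omega
  obtain ⟨m, hm, hmin⟩ := Finset.exists_min_image S G hne
  set t := G m
  have hk' : (0:ℝ) < k := by exact_mod_cast hk
  have h1 : ∑ i, w i * (G i - t) ≤ ∑ i ∈ S, b * (G i - t) := by
    calc ∑ i, w i * (G i - t) ≤ ∑ i, (if i ∈ S then b * (G i - t) else 0) := by
          apply Finset.sum_le_sum
          intro i _
          split_ifs with hi
          · exact mul_le_mul_of_nonneg_right (hwb i) (by linarith [hmin i hi])
          · exact mul_nonpos_of_nonneg_of_nonpos (hw0 i) (by linarith [hmon m hm i hi])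
      _ = _ := by simp
  have h2 : ∑ i, w i * (G i - t) = ∑ i, w i * G i - (∑ i, w i) * t := by
    rw [Finset.sum_mul, ← Finset.sum_sub_distrib]
    exact Finset.sum_congr rfl fun i _ => by ring
  have h3 : ∑ i ∈ S, b * (G i - t) = b * (∑ i ∈ S, G i - k * t) := by
    rw [← Finset.mul_sum, Finset.sum_sub_distrib]; simp [hS]
  have h4 : ∑ i ∈ S, G i - k * t ≤ k * 1 := by
    have : ∑ i ∈ S, G i ≤ ∑ i ∈ S, (1:ℝ) := Finset.sum_le_sum fun i _ => hG1 i
    simp [hS] at this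
    have : 0 ≤ (k:ℝ) * t := mul_nonneg hk'.le (hG0 m)
    linarith
  have hbk : 0 ≤ b - (k:ℝ)⁻¹ := by
    rw [sub_nonneg, inv_le_iff_one_le_mul₀ hk']; linarith
  have h5 : (b - (k:ℝ)⁻¹) * (∑ i ∈ S, G i - k * t) ≤ b := by
    calc _ ≤ (b - (k:ℝ)⁻¹) * (k * 1) := mul_le_mul_of_nonneg_left h4 hbk
      _ = k * b - 1 := by field_simp
      _ ≤ b := by linarith
  have h6 : (k:ℝ)⁻¹ * (k * t) = t := by field_simp
  have h7 : (∑ i, w i - 1) * t ≤ max (∑ i, w i - 1) 0 := by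
    have ht0 : 0 ≤ t := hG0 m
    have ht1 : t ≤ 1 := hG1 m
    calc (∑ i, w i - 1) * t ≤ max (∑ i, w i - 1) 0 * t :=
          mul_le_mul_of_nonneg_right (le_max_left _ _) ht0
      _ ≤ max (∑ i, w i - 1) 0 * 1 := mul_le_mul_of_nonneg_left ht1 (le_max_right _ _)
      _ = _ := mul_one _
  nlinarith

/-- First absolute moment bound. -/
lemma aux_var (μ : Measure Y) [IsProbabilityMeasure μ] (f : Y → ℝ) (hf : Measurable f)
    (M : ℝ) (hM : 1 ≤ M) (hf0 : ∀ y, 0 ≤ f y) (hfM : ∀ y, f y ≤ M) (hf1 : ∫ y, f y ∂μ ≤ 1)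
    (N : ℕ) (hN : 1 ≤ N) :
    ∫ ys, max (∑ i, f (ys i) / N - 1) 0 ∂(Measure.pi fun _ : Fin N => μ) ≤ √(M / N) := by
  set P := Measure.pi fun _ : Fin N => μ
  have hN' : (0:ℝ) < N := by exact_mod_cast hN
  have hmem : MemLp (fun y => f y / N) 2 μ :=
    MemLp.of_bound (by fun_prop) (M / N) (Filter.Eventually.of_forall fun y => by
      rw [Real.norm_of_nonneg (div_nonneg (hf0 y) hN'.le)]
      gcongr; exact hfM y)
  have hint : Integrable (fun y => f y / N) μ := hmem.integrable (by norm_num)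
  let W : (Fin N → Y) → ℝ := fun ys => ∑ i, f (ys i) / N
  have hWmem : MemLp W 2 P := by
    have : W = ∑ i, fun ys : Fin N → Y => f (ys i) / N := by
      ext ys; simp [W]
    rw [this]
    exact memLp_finsetSum' _ fun i _ =>
      hmem.comp_measurePreserving (measurePreserving_eval (fun _ : Fin N => μ) i)
  have hEW : ∫ ys, W ys ∂P ≤ 1 := by
    have : ∫ ys, W ys ∂P = ∑ i : Fin N, ∫ y, f y / N ∂μ := by
      simp only [W]
      rw [integral_finsetSum]
      · refine Finset.sum_congr rfl fun i _ => ?_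
        exact integral_comp_eval (μ := fun _ : Fin N => μ) (i := i) (f := fun y => f y / N)
          hint.aestronglyMeasurable
      · intro i _
        exact (measurePreserving_eval (fun _ : Fin N => μ) i).integrable_comp_of_integrable hint
    rw [this, integral_div]
    simp
    field_simp
    exact hf1
  have hvar : variance W P ≤ M / N := by
    have h1 : variance W P = ∑ i : Fin N, variance (fun y => f y / N) μ := by
      have : W = ∑ i, fun ys : Fin N → Y => f (ys i) / N := by
        ext ys; simp [W]
      rw [this]
      exact variance_sum_pi (μ := fun _ : Fin N => μ) (X := fun _ y => f y / N) (fun i => hmem)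
    have h2 : variance (fun y => f y / N) μ ≤ M / N ^ 2 := by
      refine (variance_le_expectation_sq hmem.aestronglyMeasurable).trans ?_
      calc ∫ y, ((fun y => f y / N) ^ 2) y ∂μ ≤ ∫ y, (M / N) * (f y / N) ∂μ := by
            apply integral_mono hmem.integrable_sq (hint.const_mul _)
            intro y
            simp only [sq]
            have := hfM y
            have := hf0 y
            gcongr
        _ = M / N ^ 2 * ∫ y, f y ∂μ := by
            rw [integral_const_mul, integral_div]; field_simp
        _ ≤ M / N ^ 2 * 1 := by gcongr
        _ = _ := mul_one _
    rw [h1]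
    calc ∑ i : Fin N, variance (fun y => f y / N) μ ≤ ∑ i : Fin N, M / N ^ 2 :=
          Finset.sum_le_sum fun i _ => h2
      _ = M / N := by simp; field_simp
  set m := ∫ ys, W ys ∂P with hm
  have hWint : Integrable W P := hWmem.integrable (by norm_num)
  have hdmem : MemLp (fun ys => |W ys - m|) 2 P := (hWmem.sub (memLp_const m)).abs
  have hstep : ∫ ys, max (W ys - 1) 0 ∂P ≤ ∫ ys, |W ys - m| ∂P := by
    apply integral_mono
    · exact (hWint.sub (integrable_const 1)).pos_part
    · exact hdmem.integrable (by norm_num)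
    · intro ys
      simp only
      apply max_le _ (abs_nonneg _)
      have := le_abs_self (W ys - m)
      linarith
  refine hstep.trans ?_
  apply Real.le_sqrt_of_sq_le
  have h3 := variance_nonneg (fun ys => |W ys - m|) P
  rw [variance_eq_sub hdmem] at h3
  have h4 : variance W P = ∫ ys, ((fun ys => |W ys - m|) ^ 2) ys ∂P := by
    rw [variance_eq_integral hWmem.aestronglyMeasurable.aemeasurable]
    simp [hm]
  simp only at h3 h4
  linarith



instance aux_unif : IsProbabilityMeasure unif01 := ⟨by simp [unif01]⟩

/-- The sampling measure. -/
def auxP (μ : Measure Y) (N : ℕ) : Measure ((Fin N → Y) × (Fin N → ℝ)) :=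
  (Measure.pi fun _ : Fin N => μ).prod (Measure.pi fun _ : Fin N => unif01)

instance aux_P_prob (μ : Measure Y) [IsProbabilityMeasure μ] (N : ℕ) :
    IsProbabilityMeasure (auxP μ N) := by unfold auxP; infer_instance

lemma aux_mp (μ : Measure Y) [IsProbabilityMeasure μ] {N : ℕ} (i : Fin N) :
    MeasurePreserving (fun ω : (Fin N → Y) × (Fin N → ℝ) => ω.1 i) (auxP μ N) μ :=
  (measurePreserving_eval (fun _ : Fin N => μ) i).comp measurePreserving_fst

/-- Event that index i is selected. -/
def auxA (rhat : Y → ℝ) (N k : ℕ) (i : Fin N) : Set ((Fin N → Y) × (Fin N → ℝ)) :=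
  {ω | (lexAbove rhat ω.1 ω.2 i).card < k}

lemma aux_meas (rhat : Y → ℝ) (hr : Measurable rhat) (N k : ℕ) (i : Fin N) :
    MeasurableSet (auxA rhat N k i) := by
  have : Measurable fun ω : (Fin N → Y) × (Fin N → ℝ) => (lexAbove rhat ω.1 ω.2 i).card := by
    simp only [lexAbove, Finset.card_filter]
    refine Finset.measurable_sum _ fun j _ => ?_
    refine Measurable.ite ?_ measurable_const measurable_const
    have h1 : Measurable fun ω : (Fin N → Y) × (Fin N → ℝ) => rhat (ω.1 i) := by fun_prop
    have h2 : Measurable fun ω : (Fin N → Y) × (Fin N → ℝ) => rhat (ω.1 j) := by fun_prop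
    have h3 : Measurable fun ω : (Fin N → Y) × (Fin N → ℝ) => ω.2 i := by fun_prop
    have h4 : Measurable fun ω : (Fin N → Y) × (Fin N → ℝ) => ω.2 j := by fun_prop
    exact (measurableSet_lt h1 h2).union ((measurableSet_eq_fun h1 h2).inter
      ((measurableSet_lt h3 h4).union ((measurableSet_eq_fun h3 h4).inter (MeasurableSet.const _))))
  exact this (measurableSet_Iio (a := k))

lemma aux_int {μ : Measure Y} [IsFiniteMeasure μ] {g : Y → ℝ} (hg : Measurable g)
    (h0 : ∀ y, 0 ≤ g y) (B : ℝ) (h1 : ∀ y, g y ≤ B) : Integrable g μ :=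
  Integrable.of_bound hg.aestronglyMeasurable B (Filter.Eventually.of_forall fun y => by
    rw [Real.norm_of_nonneg (h0 y)]; exact h1 y)

lemma aux_emp (μ : Measure Y) [IsProbabilityMeasure μ] (rhat : Y → ℝ) (hr : Measurable rhat)
    (N k : ℕ) (g : Y → ℝ) (hg : Measurable g) (h0 : ∀ y, 0 ≤ g y) (B : ℝ) (h1 : ∀ y, g y ≤ B) :
    ∫ y, g y ∂(empPolicy μ rhat N k) =
      (k : ℝ)⁻¹ * ∑ i : Fin N, ∫ ω in auxA rhat N k i, g (ω.1 i) ∂(auxP μ N) := by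
  unfold empPolicy
  rw [integral_smul_measure, integral_finsetSum_measure]
  · simp only [ENNReal.toReal_inv, ENNReal.toReal_natCast, smul_eq_mul]
    congr 1
    refine Finset.sum_congr rfl fun i _ => ?_
    rw [integral_map]
    · rfl
    · fun_prop
    · exact hg.aestronglyMeasurable
  · intro i _
    haveI : IsFiniteMeasure (Measure.map (fun ω : (Fin N → Y) × (Fin N → ℝ) => ω.1 i)
      (((Measure.pi fun _ : Fin N => μ).prod (Measure.pi fun _ : Fin N => unif01)).restrict
        {ω : (Fin N → Y) × (Fin N → ℝ) | (lexAbove rhat ω.1 ω.2 i).card < k})) := by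
      infer_instance
    exact aux_int hg h0 B h1

lemma aux_emp_le (μ : Measure Y) [IsProbabilityMeasure μ] (rhat : Y → ℝ) (hr : Measurable rhat)
    (N k : ℕ) (M : ℝ) (hM : (k : ℝ)⁻¹ * N ≤ M) (g : Y → ℝ) (hg : Measurable g)
    (h0 : ∀ y, 0 ≤ g y) (B : ℝ) (h1 : ∀ y, g y ≤ B) :
    ∫ y, g y ∂(empPolicy μ rhat N k) ≤ M * ∫ y, g y ∂μ := by
  rw [aux_emp μ rhat hr N k g hg h0 B h1]
  have hi : ∀ i : Fin N, ∫ ω in auxA rhat N k i, g (ω.1 i) ∂(auxP μ N) ≤ ∫ y, g y ∂μ := by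
    intro i
    have hint : Integrable (fun ω : (Fin N → Y) × (Fin N → ℝ) => g (ω.1 i)) (auxP μ N) :=
      (aux_mp μ i).integrable_comp_of_integrable (aux_int hg h0 B h1)
    calc _ ≤ ∫ ω, g (ω.1 i) ∂(auxP μ N) :=
          setIntegral_le_integral hint (Filter.Eventually.of_forall fun ω => h0 _)
      _ = _ := by
          conv_rhs => rw [← (aux_mp μ i).map_eq,
            integral_map (by fun_prop) hg.aestronglyMeasurable]
  have hnn : 0 ≤ ∫ y, g y ∂μ := integral_nonneg h0
  calc _ ≤ (k : ℝ)⁻¹ * ∑ i : Fin N, ∫ y, g y ∂μ := by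
        gcongr with i _; exact hi i
    _ = ((k : ℝ)⁻¹ * N) * ∫ y, g y ∂μ := by simp; ring
    _ ≤ _ := by gcongr

lemma aux_core (μ : Measure Y) [IsProbabilityMeasure μ] (rhat : Y → ℝ) (hr : Measurable rhat)
    (f : Y → ℝ) (hf : Measurable f)
    (M : ℝ) (hM : 1 ≤ M) (hf0 : ∀ y, 0 ≤ f y) (hfM : ∀ y, f y ≤ M) (hf1 : ∫ y, f y ∂μ ≤ 1)
    (N : ℕ) (hN : 1 ≤ N) (G : Y → ℝ) (hG : Measurable G) (hG0 : ∀ y, 0 ≤ G y)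
    (hG1 : ∀ y, G y ≤ 1) (hmon : ∀ y z, rhat y ≤ rhat z → G y ≤ G z) :
    ∫ y, f y * G y ∂μ - ∫ y, G y ∂(empPolicy μ rhat N ⌈(N : ℝ) / M⌉₊) ≤ √(M / N) + M / N := by
  set k := ⌈(N : ℝ) / M⌉₊ with hkdef
  have hN' : (0:ℝ) < N := by exact_mod_cast hN
  have hM0 : 0 < M := by linarith
  have hk0 : 0 < k := Nat.ceil_pos.mpr (by positivity)
  have hk1 : (N : ℝ) / M ≤ k := Nat.le_ceil _
  have hk2 : (k : ℝ) < N / M + 1 := Nat.ceil_lt_add_one (by positivity)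
  have hkN : k ≤ N := Nat.ceil_le.mpr (div_le_self hN'.le hM)
  have hb1 : 1 ≤ k * (M / N) := by
    calc (1:ℝ) = N / M * (M / N) := by field_simp
      _ ≤ _ := by gcongr
  have hb2 : k * (M / N) ≤ 1 + M / N := by
    calc (k:ℝ) * (M / N) ≤ (N / M + 1) * (M / N) := by gcongr
      _ = _ := by field_simp
  have hfG0 : ∀ y, 0 ≤ f y * G y := fun y => mul_nonneg (hf0 y) (hG0 y)
  have hfG1 : ∀ y, f y * G y ≤ M := fun y => by nlinarith [hf0 y, hfM y, hG0 y, hG1 y]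
  have hfGm : Measurable fun y => f y * G y := hf.mul hG
  -- left term
  have hL : ∫ y, f y * G y ∂μ =
      ∫ ω, ∑ i : Fin N, f (ω.1 i) / N * G (ω.1 i) ∂(auxP μ N) := by
    rw [integral_finsetSum]
    · have : ∀ i : Fin N, ∫ ω, f (ω.1 i) / N * G (ω.1 i) ∂(auxP μ N) =
          (N:ℝ)⁻¹ * ∫ y, f y * G y ∂μ := by
        intro i
        conv_rhs => rw [← (aux_mp μ i).map_eq,
          integral_map (by fun_prop) hfGm.aestronglyMeasurable, ← integral_const_mul]
        refine integral_congr_ae (Filter.Eventually.of_forall fun ω => ?_)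
        simp only
        ring
      rw [Finset.sum_congr rfl fun i _ => this i]
      simp
      field_simp
    · intro i _
      have := ((aux_mp μ i).integrable_comp_of_integrable
        (aux_int (μ := μ) hfGm hfG0 M hfG1)).div_const (N:ℝ)
      refine this.congr (Filter.Eventually.of_forall fun ω => ?_)
      simp only [Function.comp]
      ring
  have hLint : Integrable (fun ω : (Fin N → Y) × (Fin N → ℝ) =>
      ∑ i : Fin N, f (ω.1 i) / N * G (ω.1 i)) (auxP μ N) := by
    refine integrable_finsetSum _ fun i _ => ?_
    have := ((aux_mp μ i).integrable_comp_of_integrable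
        (aux_int (μ := μ) hfGm hfG0 M hfG1)).div_const (N:ℝ)
    refine this.congr (Filter.Eventually.of_forall fun ω => ?_)
    simp only [Function.comp]
    ring
  have hGi : ∀ i : Fin N, Integrable ((auxA rhat N k i).indicator
      fun ω : (Fin N → Y) × (Fin N → ℝ) => G (ω.1 i)) (auxP μ N) := fun i =>
    ((aux_mp μ i).integrable_comp_of_integrable (aux_int (μ := μ) hG hG0 1 hG1)).indicator
      (aux_meas rhat hr N k i)
  have hR : ∫ y, G y ∂(empPolicy μ rhat N k) =
      ∫ ω, (k:ℝ)⁻¹ * ∑ i : Fin N, (auxA rhat N k i).indicator (fun ω => G (ω.1 i)) ω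
        ∂(auxP μ N) := by
    rw [aux_emp μ rhat hr N k G hG hG0 1 hG1, integral_const_mul, integral_finsetSum]
    · congr 1
      refine Finset.sum_congr rfl fun i _ => ?_
      rw [integral_indicator (aux_meas rhat hr N k i)]
    · intro i _; exact hGi i
  have hRint : Integrable (fun ω => (k:ℝ)⁻¹ * ∑ i : Fin N,
      (auxA rhat N k i).indicator (fun ω => G (ω.1 i)) ω) (auxP μ N) :=
    (integrable_finsetSum _ fun i _ => hGi i).const_mul _
  have hWint : Integrable (fun ys : Fin N → Y => max (∑ i, f (ys i) / N - 1) 0)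
      (Measure.pi fun _ : Fin N => μ) := by
    refine Integrable.pos_part (Integrable.sub (integrable_finsetSum _ fun i _ => ?_)
      (integrable_const _))
    exact ((measurePreserving_eval (fun _ : Fin N => μ) i).integrable_comp_of_integrable
      (aux_int (μ := μ) hf hf0 M hfM)).div_const (N:ℝ)
  have hfst : MeasurePreserving (Prod.fst : (Fin N → Y) × (Fin N → ℝ) → (Fin N → Y))
      (auxP μ N) (Measure.pi fun _ : Fin N => μ) := measurePreserving_fst
  have hWint' : Integrable (fun ω : (Fin N → Y) × (Fin N → ℝ) =>
      max (∑ i, f (ω.1 i) / N - 1) 0) (auxP μ N) := hfst.integrable_comp_of_integrable hWint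
  have hWeq : ∫ ω, max (∑ i, f (ω.1 i) / N - 1) 0 ∂(auxP μ N) =
      ∫ ys, max (∑ i, f (ys i) / N - 1) 0 ∂(Measure.pi fun _ : Fin N => μ) := by
    rw [← hfst.map_eq] at hWint ⊢
    rw [integral_map (by fun_prop) hWint.aestronglyMeasurable]
  rw [hL, hR, ← integral_sub hLint hRint]
  calc _ ≤ ∫ ω : (Fin N → Y) × (Fin N → ℝ),
        (max (∑ i, f (ω.1 i) / N - 1) 0 + M / N) ∂(auxP μ N) := by
        refine integral_mono (hLint.sub hRint) (hWint'.add (integrable_const _)) fun ω => ?_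
        have := aux_det (Finset.univ.filter fun i => (lexAbove rhat ω.1 ω.2 i).card < k) k hk0
          (aux_card_top rhat ω.1 ω.2 k hkN) (fun i => f (ω.1 i) / N) (fun i => G (ω.1 i)) (M / N)
          (fun i => div_nonneg (hf0 _) hN'.le)
          (fun i => div_le_div_of_nonneg_right (hfM _) hN'.le)
          hb1 hb2 (fun i => hG0 _) (fun i => hG1 _) (by
            intro i hi j hj
            apply hmon
            by_contra hlt
            push Not at hlt
            simp only [Finset.mem_filter, Finset.mem_univ, true_and] at hi hj
            have := aux_card_lt rhat ω.1 ω.2 i j (by simp [lexAbove, hlt])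
            omega)
        rw [Finset.sum_filter] at this
        have hind : ∀ i : Fin N, (auxA rhat N k i).indicator (fun ω => G (ω.1 i)) ω =
            if (lexAbove rhat ω.1 ω.2 i).card < k then G (ω.1 i) else 0 := by
          intro i
          by_cases h : (lexAbove rhat ω.1 ω.2 i).card < k
          · rw [if_pos h, Set.indicator_of_mem (show ω ∈ auxA rhat N k i from h)]
          · rw [if_neg h, Set.indicator_of_notMem (show ω ∉ auxA rhat N k i from h)]
        simp only [Pi.sub_apply, hind]
        exact this
    _ = ∫ ys, max (∑ i, f (ys i) / N - 1) 0 ∂(Measure.pi fun _ : Fin N => μ) + M / N := by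
        rw [integral_add hWint' (integrable_const _), hWeq]; simp
    _ ≤ _ := by
        have := aux_var μ f hf M hM hf0 hfM hf1 N hN
        linarith

lemma aux_phi0 (r : Y → ℝ) (y z : Y) : 0 ≤ phi r y z := by
  unfold phi; split_ifs <;> norm_num

lemma aux_phi1 (r : Y → ℝ) (y z : Y) : phi r y z ≤ 1 := by
  unfold phi; split_ifs <;> first | (norm_num; done) | (exfalso; linarith)

lemma aux_phi_mono (r : Y → ℝ) (y y' z : Y) (h : r y ≤ r y') : phi r y z ≤ phi r y' z := by
  unfold phi; split_ifs <;> first | (norm_num; done) | (exfalso; linarith) | (exfalso; grind)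

lemma aux_phi_meas (r : Y → ℝ) (hr : Measurable r) :
    Measurable (Function.uncurry (phi r)) := by
  unfold phi Function.uncurry
  have h1 : Measurable fun p : Y × Y => r p.1 := by fun_prop
  have h2 : Measurable fun p : Y × Y => r p.2 := by fun_prop
  exact (Measurable.ite (measurableSet_lt h2 h1) measurable_const measurable_const).add
    ((Measurable.ite (measurableSet_eq_fun h1 h2) measurable_const measurable_const).const_mul _)

lemma aux_main (πref q : Measure Y) [IsProbabilityMeasure πref] [IsProbabilityMeasure q]
    (hq : q ≪ πref) (L : ℝ) (hL : 1 ≤ L) (hqL : ∀ᵐ y ∂πref, (q.rnDeriv πref y).toReal ≤ L)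
    (rstar rhat : Y → ℝ) (hrs : Measurable rstar) (hr : Measurable rhat)
    (πstar : Measure Y) [IsProbabilityMeasure πstar] (hs : πstar ≪ πref)
    (M : ℝ) (hM : 1 ≤ M) (N : ℕ) (hN : 1 ≤ N) :
    winRateQ q rstar πstar -
        winRateQ q rstar (empPolicy πref rhat N ⌈(N : ℝ) / M⌉₊) ≤
      2 * (L * EMdiv M πstar πref + L * M * epw πref rhat rstar +
        Real.sqrt (M / (N : ℝ))) := by
  have hN' : (0:ℝ) < N := by exact_mod_cast hN
  have hM0 : 0 < M := by linarith
  set k := ⌈(N : ℝ) / M⌉₊ with hkdef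
  have hk0 : 0 < k := Nat.ceil_pos.mpr (by positivity)
  have hk0' : (0:ℝ) < k := by exact_mod_cast hk0
  have hk1 : (N : ℝ) / M ≤ k := Nat.le_ceil _
  have hkM : (k:ℝ)⁻¹ * N ≤ M := by
    rw [div_le_iff₀ hM0] at hk1
    rw [inv_mul_le_iff₀ hk0']; exact hk1
  have hphiI : ∀ (r : Y → ℝ) (_ : Measurable r) (ν : Measure Y) [IsProbabilityMeasure ν] (y : Y),
      Integrable (phi r y) ν := fun r h ν _ y =>
    aux_int ((aux_phi_meas r h).comp measurable_prodMk_left) (aux_phi0 r y) 1 (aux_phi1 r y)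
  have hgm : ∀ (r : Y → ℝ) (_ : Measurable r), Measurable fun y => ∫ y', phi r y y' ∂q :=
    fun r h => ((aux_phi_meas r h).stronglyMeasurable.integral_prod_right).measurable
  have hg0 : ∀ (r : Y → ℝ) y, 0 ≤ ∫ y', phi r y y' ∂q := fun r y =>
    integral_nonneg (aux_phi0 r y)
  have hg1 : ∀ (r : Y → ℝ) (_ : Measurable r) y, ∫ y', phi r y y' ∂q ≤ 1 := fun r h y => by
    calc ∫ y', phi r y y' ∂q ≤ ∫ y', (1:ℝ) ∂q :=
          integral_mono (hphiI r h q y) (integrable_const _) (aux_phi1 r y)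
      _ = 1 := by simp
  set g : Y → ℝ := fun y => ∫ y', phi rstar y y' ∂q with hg
  set G : Y → ℝ := fun y => ∫ y', phi rhat y y' ∂q with hG
  set e : Y → ℝ := fun y => ∫ y', |phi rhat y y' - phi rstar y y'| ∂πref with he
  have hdm : Measurable (Function.uncurry fun y y' => |phi rhat y y' - phi rstar y y'|) :=
    (((aux_phi_meas rhat hr).sub (aux_phi_meas rstar hrs))).norm
  have hd1 : ∀ y y', |phi rhat y y' - phi rstar y y'| ≤ 1 := fun y y' => by
    rw [abs_le]
    constructor <;> linarith [aux_phi0 rhat y y', aux_phi1 rhat y y', aux_phi0 rstar y y',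
      aux_phi1 rstar y y']
  have hdI : ∀ y, Measurable fun y' => |phi rhat y y' - phi rstar y y'| := fun y =>
    hdm.comp measurable_prodMk_left
  have hem : Measurable e := (hdm.stronglyMeasurable.integral_prod_right).measurable
  have he0 : ∀ y, 0 ≤ e y := fun y => integral_nonneg fun y' => abs_nonneg _
  have he1 : ∀ y, e y ≤ 1 := fun y => by
    calc e y ≤ ∫ y', (1:ℝ) ∂πref :=
          integral_mono (aux_int (hdI y) (fun _ => abs_nonneg _) 1 (hd1 y))
            (integrable_const _) (hd1 y)
      _ = 1 := by simp
  have hgG : ∀ y, |G y - g y| ≤ L * e y := by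
    intro y
    have hDI : Integrable (fun y' => |phi rhat y y' - phi rstar y y'|) πref :=
      aux_int (hdI y) (fun _ => abs_nonneg _) 1 (hd1 y)
    calc |G y - g y| = |∫ y', (phi rhat y y' - phi rstar y y') ∂q| := by
          rw [integral_sub (hphiI rhat hr q y) (hphiI rstar hrs q y)]
      _ ≤ ∫ y', |phi rhat y y' - phi rstar y y'| ∂q := abs_integral_le_integral_abs
      _ = ∫ y', (q.rnDeriv πref y').toReal * |phi rhat y y' - phi rstar y y'| ∂πref :=
          (integral_toReal_rnDeriv_mul hq).symm
      _ ≤ ∫ y', L * |phi rhat y y' - phi rstar y y'| ∂πref := by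
          apply integral_mono_of_nonneg
          · exact Filter.Eventually.of_forall fun y' =>
              mul_nonneg ENNReal.toReal_nonneg (abs_nonneg _)
          · exact hDI.const_mul _
          · filter_upwards [hqL] with y' hy'
            exact mul_le_mul_of_nonneg_right hy' (abs_nonneg _)
      _ = L * e y := integral_const_mul _ _
  have hepw : epw πref rhat rstar = ∫ y, e y ∂πref := rfl
  have hepw0 : 0 ≤ epw πref rhat rstar := integral_nonneg he0
  have hEM0 : 0 ≤ EMdiv M πstar πref := integral_nonneg fun y => le_max_right _ _
  have hw1 : winRateQ q rstar πstar = ∫ y, g y ∂πstar := rfl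
  have hw2 : winRateQ q rstar (empPolicy πref rhat N k) =
    ∫ y, g y ∂(empPolicy πref rhat N k) := rfl
  have hgI : ∀ (ν : Measure Y) [IsFiniteMeasure ν], Integrable g ν := fun ν _ =>
    aux_int (hgm rstar hrs) (hg0 rstar) 1 (hg1 rstar hrs)
  have hGI : ∀ (ν : Measure Y) [IsFiniteMeasure ν], Integrable G ν := fun ν _ =>
    aux_int (hgm rhat hr) (hg0 rhat) 1 (hg1 rhat hr)
  have heI : ∀ (ν : Measure Y) [IsFiniteMeasure ν], Integrable e ν := fun ν _ =>
    aux_int hem he0 1 he1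
  have hLe : 0 ≤ L * EMdiv M πstar πref := by positivity
  have hLM : 0 ≤ L * M * epw πref rhat rstar := by positivity
  rcases le_or_gt (M / N) 1 with hMN | hMN
  swap
  · have h1 : ∫ y, g y ∂πstar ≤ 1 := by
      calc ∫ y, g y ∂πstar ≤ ∫ y, (1:ℝ) ∂πstar :=
            integral_mono (hgI _) (integrable_const _) (hg1 rstar hrs)
        _ = 1 := by simp
    have h2 : 0 ≤ ∫ y, g y ∂(empPolicy πref rhat N k) := integral_nonneg (hg0 rstar)
    have h3 : 1 ≤ √(M / N) := Real.one_le_sqrt.mpr hMN.le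
    rw [hw1, hw2]
    linarith
  have hsq : M / N ≤ √(M / N) := Real.le_sqrt_of_sq_le (by
    have : 0 ≤ M / N := by positivity
    nlinarith)
  -- truncated density
  set p : Y → ℝ := fun y => (πstar.rnDeriv πref y).toReal with hp
  have hpm : Measurable p := (Measure.measurable_rnDeriv _ _).ennreal_toReal
  have hp0 : ∀ y, 0 ≤ p y := fun y => ENNReal.toReal_nonneg
  have hpI : Integrable p πref := Measure.integrable_toReal_rnDeriv
  have hp1 : ∫ y, p y ∂πref = 1 := by
    rw [Measure.integral_toReal_rnDeriv hs]; simp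
  set f : Y → ℝ := fun y => min (p y) M with hf
  have hfm : Measurable f := hpm.min measurable_const
  have hf0 : ∀ y, 0 ≤ f y := fun y => le_min (hp0 y) hM0.le
  have hfM : ∀ y, f y ≤ M := fun y => min_le_right _ _
  have hfI : Integrable f πref := aux_int hfm hf0 M hfM
  have hf1 : ∫ y, f y ∂πref ≤ 1 := by
    rw [← hp1]; exact integral_mono hfI hpI fun y => min_le_left _ _
  have hbI : ∀ (u : Y → ℝ), Measurable u → (∀ y, 0 ≤ u y) → (∀ y, u y ≤ 1) →
      Integrable (fun y => f y * u y) πref := fun u hu h0 h1 =>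
    aux_int (hfm.mul hu) (fun y => mul_nonneg (hf0 y) (h0 y)) M fun y => by
      nlinarith [hf0 y, hfM y, h0 y, h1 y]
  have hEMI : Integrable (fun y => max (p y - M) 0) πref :=
    (hpI.sub (integrable_const M)).pos_part
  have s1 : ∫ y, g y ∂πstar ≤ ∫ y, f y * g y ∂πref + EMdiv M πstar πref := by
    rw [← integral_toReal_rnDeriv_mul hs]
    unfold EMdiv
    rw [← integral_add (hbI g (hgm rstar hrs) (hg0 rstar) (hg1 rstar hrs)) hEMI]
    apply integral_mono_of_nonneg
    · exact Filter.Eventually.of_forall fun y => mul_nonneg (hp0 y) (hg0 rstar y)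
    · exact (hbI g (hgm rstar hrs) (hg0 rstar) (hg1 rstar hrs)).add hEMI
    · refine Filter.Eventually.of_forall fun y => ?_
      have h1 : p y = f y + max (p y - M) 0 := by
        simp only [hf]
        rcases le_total (p y) M with h | h
        · rw [min_eq_left h, max_eq_right (by linarith)]; ring
        · rw [min_eq_right h, max_eq_left (by linarith)]; ring
      change p y * g y ≤ f y * g y + max (p y - M) 0
      have h2 : 0 ≤ max (p y - M) 0 := le_max_right _ _
      have h3 : g y ≤ 1 := hg1 rstar hrs y
      have h4 : max (p y - M) 0 * g y ≤ max (p y - M) 0 * 1 := mul_le_mul_of_nonneg_left h3 h2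
      calc p y * g y = f y * g y + max (p y - M) 0 * g y := by rw [← add_mul, ← h1]
        _ ≤ _ := by linarith
  have s2 : ∫ y, f y * g y ∂πref ≤ ∫ y, f y * G y ∂πref + L * M * epw πref rhat rstar := by
    rw [hepw, ← integral_const_mul,
      ← integral_add (hbI G (hgm rhat hr) (hg0 rhat) (hg1 rhat hr)) ((heI πref).const_mul _)]
    apply integral_mono (hbI g (hgm rstar hrs) (hg0 rstar) (hg1 rstar hrs))
      ((hbI G (hgm rhat hr) (hg0 rhat) (hg1 rhat hr)).add ((heI πref).const_mul _))
    intro y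
    have h1 : g y - G y ≤ L * e y := by
      have := hgG y; rw [abs_le] at this; linarith
    have h2 : 0 ≤ L * e y := mul_nonneg (by linarith) (he0 y)
    have h3 : f y * (g y - G y) ≤ f y * (L * e y) := mul_le_mul_of_nonneg_left h1 (hf0 y)
    have h4 : f y * (L * e y) ≤ M * (L * e y) := mul_le_mul_of_nonneg_right (hfM y) h2
    change f y * g y ≤ f y * G y + L * M * e y
    linarith
  have s3 := aux_core πref rhat hr f hfm M hM hf0 hfM hf1 N hN G (hgm rhat hr) (hg0 rhat)
    (hg1 rhat hr) (fun y z hyz => integral_mono (hphiI rhat hr q y) (hphiI rhat hr q z)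
      fun y' => aux_phi_mono rhat y z y' hyz)
  have s4 : ∫ y, G y ∂(empPolicy πref rhat N k) ≤
      ∫ y, g y ∂(empPolicy πref rhat N k) + L * M * epw πref rhat rstar := by
    have h1 := aux_emp_le πref rhat hr N k M hkM e hem he0 1 he1
    haveI : IsFiniteMeasure (empPolicy πref rhat N k) := by
      unfold empPolicy
      refine Measure.smul_finite _ ?_
      simp [hk0.ne']
    have h2 : ∫ y, G y ∂(empPolicy πref rhat N k) ≤
        ∫ y, (g y + L * e y) ∂(empPolicy πref rhat N k) := by
      apply integral_mono (hGI _) ((hgI _).add ((heI _).const_mul _))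
      intro y
      have := hgG y; rw [abs_le] at this
      change G y ≤ g y + L * e y
      linarith
    rw [integral_add (hgI _) ((heI _).const_mul _), integral_const_mul] at h2
    have h3 := mul_le_mul_of_nonneg_left h1 (by linarith : 0 ≤ L)
    rw [hepw]
    linarith
  rw [← hkdef] at s3
  have hE : EMdiv M πstar πref ≤ L * EMdiv M πstar πref := le_mul_of_one_le_left hEM0 hL
  rw [hw1, hw2]
  linarith

end Aux

/-- **`E_M`-regularized Best-of-N win-rate regret upper bound against an arbitrary
comparison measure `q`.** There is a universal constant `C > 0` such that if `q ≪ πref`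
with density ratio bounded by `L ≥ 1` `πref`-a.e., then for measurable rewards `r⋆, r̂`,
comparator `π⋆ ≪ πref`, real `M ≥ 1`, and integer `N ≥ 1`, the empirical
`E_M`-regularized Best-of-N policy `π̂_M` (with `k = ⌈N/M⌉`) satisfies
`R_q^{r⋆}(π⋆) − R_q^{r⋆}(π̂_M) ≤ C (L·E_M(π⋆‖πref) + L·M·ε_pw(r̂) + √(M/N))`. -/
theorem stmt_7 :
    ∃ C : ℝ, 0 < C ∧
      ∀ (Y : Type) [MeasurableSpace Y]
        (πref q : Measure Y) [IsProbabilityMeasure πref] [IsProbabilityMeasure q],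
        q ≪ πref →
        ∀ (L : ℝ), 1 ≤ L → (∀ᵐ y ∂πref, (q.rnDeriv πref y).toReal ≤ L) →
        ∀ (rstar rhat : Y → ℝ), Measurable rstar → Measurable rhat →
        ∀ (πstar : Measure Y) [IsProbabilityMeasure πstar], πstar ≪ πref →
        ∀ (M : ℝ), 1 ≤ M → ∀ (N : ℕ), 1 ≤ N →
          winRateQ q rstar πstar -
              winRateQ q rstar (empPolicy πref rhat N ⌈(N : ℝ) / M⌉₊) ≤
            C * (L * EMdiv M πstar πref + L * M * epw πref rhat rstar +
              Real.sqrt (M / (N : ℝ))) := by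
  exact ⟨2, by norm_num, fun Y _ πref q _ _ hq L hL hqL rstar rhat hrs hr πstar _ hs M hM N hN =>
    aux_main πref q hq L hL hqL rstar rhat hrs hr πstar hs M hM N hN⟩
end
end

section
/- Fix R_max > 0, p ∈ (0,1), and ε > 0. Let Y = ({H} ⊔ [0, ε/2]) × {−1, +1}, and let π_ref = μ ⊗ Unif{−1,+1}, where μ is the probability measure on {H} ⊔ [0, ε/2] that equals H with probability p and otherwise is uniform on [0, ε/2]. Define r⋆ on Y by r⋆((H,γ)) = R_max and r⋆((u,γ)) = u for u ∈ [0, ε/2], and define r̂((y,γ)) = r⋆((y,γ)) + ε·γ. Then: (i) ∫ (r̂ − r⋆)² dπ_ref = ε²; (ii) ε_pw(r̂) ≥ (1−p)²/4; and (iii) Var_{π_ref}(r⋆) ≥ p(1−p)·(R_max − ε/4)². -/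
open MeasureTheory ENNReal

noncomputable section

section Helpers

lemma aux_formula (p : ℝ) (hp0 : 0 < p) (hp1 : p < 1) (l : Measure ℝ) [IsProbabilityMeasure l]
    (f : (Unit ⊕ ℝ) × Bool → ℝ) (hf : Measurable f)
    (hi : ∀ b, Integrable (fun u => f (Sum.inr u, b)) l) :
    ∫ y, f y ∂((ENNReal.ofReal p • Measure.dirac (Sum.inl ()) +
        ENNReal.ofReal (1 - p) • Measure.map Sum.inr l).prod
        ((2 : ℝ≥0∞)⁻¹ • (Measure.dirac true + Measure.dirac false))) =
      p * ((f (Sum.inl (), true) + f (Sum.inl (), false)) / 2) +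
      (1 - p) * ∫ u, (f (Sum.inr u, true) + f (Sum.inr u, false)) / 2 ∂l := by
  have hm : ∀ b, Measurable (fun x : Unit ⊕ ℝ => f (x, b)) := fun b =>
    hf.comp (measurable_id.prodMk measurable_const)
  have hi1 : ∀ b, Integrable (fun x : Unit ⊕ ℝ => f (x, b))
      (ENNReal.ofReal p • Measure.dirac (Sum.inl ())) := fun b =>
    (integrable_dirac' (hm b).stronglyMeasurable (by simp)).smul_measure (by simp)
  have hi2 : ∀ b, Integrable (fun x : Unit ⊕ ℝ => f (x, b))
      (ENNReal.ofReal (1 - p) • Measure.map Sum.inr l) := fun b =>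
    ((integrable_map_measure (hm b).aestronglyMeasurable measurable_inr.aemeasurable).2
      (hi b)).smul_measure (by simp)
  have key : ∀ b, ∫ x, f (x, b) ∂(ENNReal.ofReal p • Measure.dirac (Sum.inl ()) +
        ENNReal.ofReal (1 - p) • Measure.map Sum.inr l) =
      p * f (Sum.inl (), b) + (1 - p) * ∫ u, f (Sum.inr u, b) ∂l := by
    intro b
    rw [integral_add_measure (hi1 b) (hi2 b), integral_smul_measure, integral_smul_measure,
      integral_dirac' _ _ (hm b).stronglyMeasurable,
      integral_map measurable_inr.aemeasurable (hm b).aestronglyMeasurable,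
      ENNReal.toReal_ofReal hp0.le, ENNReal.toReal_ofReal (by linarith)]
    simp
  have hmk : ∀ b : Bool, Measurable (fun x : Unit ⊕ ℝ => (x, b)) := fun b =>
    measurable_id.prodMk measurable_const
  have hi3 : ∀ b, Integrable f (Measure.map (fun x : Unit ⊕ ℝ => (x, b))
      (ENNReal.ofReal p • Measure.dirac (Sum.inl ()) +
        ENNReal.ofReal (1 - p) • Measure.map Sum.inr l)) := fun b =>
    (integrable_map_measure hf.aestronglyMeasurable (hmk b).aemeasurable).2
      ((hi1 b).add_measure (hi2 b))
  rw [Measure.prod_smul_right, Measure.prod_add, Measure.prod_dirac, Measure.prod_dirac,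
    integral_smul_measure, integral_add_measure (hi3 true) (hi3 false),
    integral_map (hmk _).aemeasurable hf.aestronglyMeasurable,
    integral_map (hmk _).aemeasurable hf.aestronglyMeasurable, key, key,
    integral_div, integral_add (hi true) (hi false)]
  simp
  ring

lemma aux_meas_s9 {Y : Type*} [MeasurableSpace Y] (r : Y → ℝ) (hr : Measurable r) :
    Measurable (fun z : Y × Y => phi r z.1 z.2) := by
  unfold phi
  have h1 : Measurable (fun z : Y × Y => r z.1) := hr.comp measurable_fst
  have h2 : Measurable (fun z : Y × Y => r z.2) := hr.comp measurable_snd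
  exact (Measurable.ite (measurableSet_lt h2 h1) measurable_const measurable_const).add
    ((Measurable.ite (measurableSet_eq_fun h1 h2) measurable_const measurable_const).const_mul _)

lemma aux_mem {Y : Type*} [MeasurableSpace Y] (r : Y → ℝ) (y y' : Y) :
    0 ≤ phi r y y' ∧ phi r y y' ≤ 1 := by
  unfold phi
  split_ifs <;> first | (exfalso; linarith) | norm_num

end Helpers

/-- **Small mean-squared error does not control pairwise error.** On
`Y = ({H} ⊔ [0, ε/2]) × {−1, +1}` (encoded as `(Unit ⊕ ℝ) × Bool`, with the base measure
placing mass `p` on `H` and otherwise uniform on `[0, ε/2]`, and independent uniform sign),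
the rewards `r⋆((H,γ)) = R_max`, `r⋆((u,γ)) = u`, and `r̂ = r⋆ + ε·γ` satisfy:
(i) `∫ (r̂ − r⋆)² dπref = ε²`; (ii) `ε_pw(r̂) ≥ (1−p)²/4`; and
(iii) `Var_{πref}(r⋆) ≥ p(1−p)(R_max − ε/4)²`. -/
theorem stmt_9 (Rmax p ε : ℝ) (hR : 0 < Rmax) (hp0 : 0 < p) (hp1 : p < 1) (hε : 0 < ε) :
    let μ : Measure (Unit ⊕ ℝ) :=
      ENNReal.ofReal p • Measure.dirac (Sum.inl ()) +
        ENNReal.ofReal (1 - p) •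
          Measure.map Sum.inr
            ((ENNReal.ofReal (ε / 2))⁻¹ • (volume : Measure ℝ).restrict (Set.Icc 0 (ε / 2)))
    let ν : Measure Bool := (2 : ℝ≥0∞)⁻¹ • (Measure.dirac true + Measure.dirac false)
    let πref : Measure ((Unit ⊕ ℝ) × Bool) := μ.prod ν
    let γval : Bool → ℝ := fun b => if b then 1 else -1
    let rstar : (Unit ⊕ ℝ) × Bool → ℝ := fun y => Sum.elim (fun _ => Rmax) id y.1
    let rhat : (Unit ⊕ ℝ) × Bool → ℝ := fun y => rstar y + ε * γval y.2
    (∫ y, (rhat y - rstar y) ^ 2 ∂πref) = ε ^ 2 ∧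
    (1 - p) ^ 2 / 4 ≤ epw πref rhat rstar ∧
    p * (1 - p) * (Rmax - ε / 4) ^ 2 ≤
      (∫ y, rstar y ^ 2 ∂πref) - (∫ y, rstar y ∂πref) ^ 2 := by
  intro μ ν πref γval rstar rhat
  set l : Measure ℝ :=
    (ENNReal.ofReal (ε / 2))⁻¹ • (volume : Measure ℝ).restrict (Set.Icc 0 (ε / 2)) with hl
  have hlP : IsProbabilityMeasure l := ⟨by
    simp only [hl, Measure.smul_apply, Measure.restrict_apply MeasurableSet.univ,
      Set.univ_inter, Real.volume_Icc, sub_zero, smul_eq_mul]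
    exact ENNReal.inv_mul_cancel (by simpa using hε) (by simp)⟩
  have hae : ∀ᵐ u ∂l, u ∈ Set.Icc 0 (ε / 2) :=
    Measure.ae_smul_measure (ae_restrict_mem measurableSet_Icc) _
  have hint : ∀ f : ℝ → ℝ, Continuous f → Integrable f l := fun f hf =>
    (hf.continuousOn.integrableOn_Icc).smul_measure (by simpa using hε)
  have hval : ∀ f : ℝ → ℝ, ∫ u, f u ∂l = (ε / 2)⁻¹ * ∫ u in (0 : ℝ)..(ε / 2), f u := by
    intro f
    rw [hl, integral_smul_measure, integral_Icc_eq_integral_Ioc,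
      intervalIntegral.integral_of_le (by linarith), ENNReal.toReal_inv,
      ENNReal.toReal_ofReal (by linarith), smul_eq_mul]
  have hrs : Measurable rstar :=
    (measurable_const.sumElim measurable_id).comp measurable_fst
  have hγ : Measurable γval := measurable_of_finite _
  have hrh : Measurable rhat := hrs.add ((hγ.comp measurable_snd).const_mul ε)
  have F : ∀ f : (Unit ⊕ ℝ) × Bool → ℝ, Measurable f →
      (∀ b, Integrable (fun u => f (Sum.inr u, b)) l) → ∫ y, f y ∂πref =
      p * ((f (Sum.inl (), true) + f (Sum.inl (), false)) / 2) +
      (1 - p) * ∫ u, (f (Sum.inr u, true) + f (Sum.inr u, false)) / 2 ∂l :=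
    fun f hf hi => aux_formula p hp0 hp1 l f hf hi
  have hμ : IsProbabilityMeasure μ := ⟨by
    have : IsProbabilityMeasure (Measure.map (Sum.inr : ℝ → Unit ⊕ ℝ) l) :=
      Measure.isProbabilityMeasure_map measurable_inr.aemeasurable
    change ENNReal.ofReal p * (Measure.dirac (Sum.inl () : Unit ⊕ ℝ)) Set.univ +
      ENNReal.ofReal (1 - p) * (Measure.map Sum.inr l) Set.univ = 1
    rw [measure_univ, measure_univ, mul_one, mul_one, ← ENNReal.ofReal_add hp0.le (by linarith)]
    simp⟩
  have hν : IsProbabilityMeasure ν := ⟨by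
    change (2 : ℝ≥0∞)⁻¹ * ((Measure.dirac true) Set.univ + (Measure.dirac false) Set.univ) = 1
    rw [measure_univ, measure_univ, one_add_one_eq_two]
    exact ENNReal.inv_mul_cancel (by simp) (by simp)⟩
  have hπ : IsProbabilityMeasure πref := by
    change IsProbabilityMeasure (μ.prod ν)
    infer_instance
  refine ⟨?_, ?_, ?_⟩
  · have : ∀ y, (rhat y - rstar y) ^ 2 = ε ^ 2 := by
      rintro ⟨x, b⟩
      cases b <;> simp [rhat, γval]
    simp [this]
  · let g : (Unit ⊕ ℝ) × Bool → (Unit ⊕ ℝ) × Bool → ℝ :=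
      fun y y' => |phi rhat y y' - phi rstar y y'|
    have hg : Measurable (Function.uncurry g) := by
      have := ((aux_meas_s9 rhat hrh).sub (aux_meas_s9 rstar hrs)).abs
      exact this
    have g0 : ∀ y y', 0 ≤ g y y' := fun y y' => abs_nonneg _
    have g1 : ∀ y y', g y y' ≤ 1 := fun y y' => by
      have a := aux_mem rhat y y'
      have b := aux_mem rstar y y'
      exact abs_le.2 ⟨by linarith, by linarith⟩
    have bint : ∀ (m : Measure ℝ) [IsProbabilityMeasure m] (f : ℝ → ℝ), Measurable f →
        (∀ x, 0 ≤ f x) → (∀ x, f x ≤ 1) → Integrable f m := fun m _ f hf h0 h1 =>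
      Integrable.of_bound hf.aestronglyMeasurable 1
        (ae_of_all _ fun x => by rw [Real.norm_eq_abs, abs_of_nonneg (h0 x)]; exact h1 x)
    have hmk : ∀ b : Bool, Measurable (fun u : ℝ => ((Sum.inr u : Unit ⊕ ℝ), b)) := fun b =>
      measurable_inr.prodMk measurable_const
    have hgy : ∀ y, Measurable (g y) := fun y => hg.comp (measurable_const.prodMk measurable_id)
    have hgi : ∀ y b, Integrable (fun u => g y (Sum.inr u, b)) l := fun y b =>
      bint l _ ((hgy y).comp (hmk b)) (fun _ => g0 _ _) (fun _ => g1 _ _)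
    let G : (Unit ⊕ ℝ) × Bool → ℝ := fun y => ∫ y', g y y' ∂πref
    have hG : Measurable G := (hg.stronglyMeasurable.integral_prod_right).measurable
    have G0 : ∀ y, 0 ≤ G y := fun y => integral_nonneg (g0 y)
    have G1 : ∀ y, G y ≤ 1 := fun y => by
      have : G y ≤ ∫ _, (1 : ℝ) ∂πref :=
        integral_mono_of_nonneg (ae_of_all _ (g0 y)) (integrable_const _) (ae_of_all _ (g1 y))
      simpa using this
    have hGi : ∀ b, Integrable (fun u => G (Sum.inr u, b)) l := fun b =>
      bint l _ (hG.comp (hmk b)) (fun _ => G0 _) (fun _ => G1 _)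
    have hpt : ∀ u ∈ Set.Icc 0 (ε / 2), ∀ v ∈ Set.Icc 0 (ε / 2),
        g (Sum.inr u, true) (Sum.inr v, false) + g (Sum.inr u, false) (Sum.inr v, true) = 1 := by
      intro u hu v hv
      obtain ⟨hu0, hu1⟩ := hu
      obtain ⟨hv0, hv1⟩ := hv
      have e1 : phi rhat (Sum.inr u, true) (Sum.inr v, false) = 1 := by
        simp only [phi, rhat, rstar, γval, Sum.elim_inr, id]
        rw [if_pos (by simp; linarith), if_neg (by simp; intro h; linarith)]
        norm_num
      have e2 : phi rhat (Sum.inr u, false) (Sum.inr v, true) = 0 := by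
        simp only [phi, rhat, rstar, γval, Sum.elim_inr, id]
        rw [if_neg (by simp; linarith), if_neg (by simp; intro h; linarith)]
        norm_num
      have e3 : ∀ b b', phi rstar (Sum.inr u, b) (Sum.inr v, b') =
        (if v < u then 1 else 0) + (1 / 2) * (if u = v then 1 else 0) := fun _ _ => rfl
      simp only [g, e1, e2, e3]
      split_ifs <;> first | (exfalso; linarith) | norm_num
    have hlow : ∀ u ∈ Set.Icc 0 (ε / 2),
        (1 - p) / 4 ≤ (G (Sum.inr u, true) + G (Sum.inr u, false)) / 2 := by
      intro u hu
      have b1 : ∀ y, (1 - p) * ∫ v, (g y (Sum.inr v, true) + g y (Sum.inr v, false)) / 2 ∂l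
          ≤ G y := fun y => by
        have := F (g y) (hgy y) (hgi y)
        have hn : 0 ≤ p * ((g y (Sum.inl (), true) + g y (Sum.inl (), false)) / 2) := by
          have := g0 y (Sum.inl (), true)
          have := g0 y (Sum.inl (), false)
          positivity
        change _ ≤ ∫ y', g y y' ∂πref
        linarith
      have b2 : (1 / 2 : ℝ) ≤
          (∫ v, (g (Sum.inr u, true) (Sum.inr v, true)
            + g (Sum.inr u, true) (Sum.inr v, false)) / 2 ∂l) +
          ∫ v, (g (Sum.inr u, false) (Sum.inr v, true)
            + g (Sum.inr u, false) (Sum.inr v, false)) / 2 ∂l := by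
        have i1 : ∀ y, Integrable
            (fun v => (g y (Sum.inr v, true) + g y (Sum.inr v, false)) / 2) l := fun y =>
          ((hgi y true).add (hgi y false)).div_const 2
        rw [← integral_add (i1 _) (i1 _)]
        have : ∫ _, (1 / 2 : ℝ) ∂l = 1 / 2 := by simp
        rw [← this]
        refine integral_mono_ae (integrable_const _) ((i1 _).add (i1 _)) ?_
        filter_upwards [hae] with v hv
        have h1 := hpt u hu v hv
        have h2 := g0 (Sum.inr u, true) (Sum.inr v, true)
        have h3 := g0 (Sum.inr u, false) (Sum.inr v, false)
        linarith
      have b3 := b1 (Sum.inr u, true)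
      have b4 := b1 (Sum.inr u, false)
      have b5 := mul_le_mul_of_nonneg_left b2 (by linarith : (0 : ℝ) ≤ 1 - p)
      rw [mul_add] at b5
      linarith
    have hfin : (1 - p) / 4 ≤ ∫ u, (G (Sum.inr u, true) + G (Sum.inr u, false)) / 2 ∂l := by
      have : ∫ _, ((1 - p) / 4 : ℝ) ∂l = (1 - p) / 4 := by simp
      rw [← this]
      refine integral_mono_ae (integrable_const _) (((hGi true).add (hGi false)).div_const 2) ?_
      filter_upwards [hae] with u hu using hlow u hu
    change _ ≤ ∫ y, G y ∂πref
    rw [F G hG hGi]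
    have h2 := G0 (Sum.inl (), true)
    have h3 := G0 (Sum.inl (), false)
    have h4 : 0 ≤ p * ((G (Sum.inl (), true) + G (Sum.inl (), false)) / 2) := by positivity
    have h5 := mul_le_mul_of_nonneg_left hfin (by linarith : (0 : ℝ) ≤ 1 - p)
    linarith
  · have e1 := F rstar hrs (fun b => hint (fun u => u) continuous_id)
    have e2 := F (fun y => rstar y ^ 2) (hrs.pow_const 2)
      (fun b => hint (fun u => u ^ 2) (continuous_pow 2))
    have m1 : ∫ u, (rstar (Sum.inr u, true) + rstar (Sum.inr u, false)) / 2 ∂l = ε / 4 := by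
      have : ∀ u : ℝ, (rstar (Sum.inr u, true) + rstar (Sum.inr u, false)) / 2 = u := by
        intro u; simp [rstar]
      simp only [this]
      rw [hval, integral_id]
      field_simp
      ring
    have m2 : ∫ u, (rstar (Sum.inr u, true) ^ 2 + rstar (Sum.inr u, false) ^ 2) / 2 ∂l
        = ε ^ 2 / 12 := by
      have : ∀ u : ℝ, (rstar (Sum.inr u, true) ^ 2 + rstar (Sum.inr u, false) ^ 2) / 2 = u ^ 2 := by
        intro u; simp [rstar]
      simp only [this]
      rw [hval, integral_pow]
      field_simp
      norm_num
      ring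
    have hH : ∀ b, rstar (Sum.inl (), b) = Rmax := fun _ => rfl
    simp only [m1, m2, hH] at e1 e2
    rw [e1, e2]
    have : 0 ≤ (1 - p) * ε ^ 2 := mul_nonneg (by linarith) (sq_nonneg _)
    nlinarith
end
end

section
/- Fix M ≥ 2, ε ∈ (0, 1/M), and R_max > 0. Let Y = [0,1], π_ref the uniform distribution on [0,1], S = [0, 1/M], and r̂ = R_max·1_S. Then for every probability measure π_A on Y and every γ > 0, there exist a bounded measurable reward function r⋆ : Y → [0, ∞) and a probability measure π⋆ ≪ π_ref such that: (i) the pairwise win-rate error between r̂ and r⋆ satisfies ε_pw(r̂) ≤ ε; (ii) E_M(π⋆ ‖ π_ref) = ε·M; and (iii) ∫ r⋆ dπ⋆ − ∫ r⋆ dπ_A ≥ γ. In particular, no bound on the expected-true-reward regret in terms of the pairwise error and the E_M-divergence alone is possible. -/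
open MeasureTheory ENNReal

noncomputable section

lemma exists_small (πA : Measure ℝ) [IsProbabilityMeasure πA] (n : ℕ) (hn : 0 < n) :
    ∃ k : ℕ, k < n ∧ πA.real (Set.Ioc ((k : ℝ) / n) (((k : ℝ) + 1) / n)) ≤ 1 / n := by
  by_contra! h
  have hn' : (0 : ℝ) < n := by exact_mod_cast hn
  have hd : (↑(Finset.range n) : Set ℕ).PairwiseDisjoint
      (fun k : ℕ => Set.Ioc ((k : ℝ) / n) (((k : ℝ) + 1) / n)) := by
    intro i _ j _ hij
    rw [Function.onFun, Set.disjoint_left]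
    rintro x ⟨h1, h2⟩ ⟨h3, h4⟩
    rw [div_lt_iff₀ hn'] at h1 h3
    rw [le_div_iff₀ hn'] at h2 h4
    have a : (i : ℝ) < j + 1 := by linarith
    have b : (j : ℝ) < i + 1 := by linarith
    norm_cast at a b
    omega
  have h1 := measureReal_biUnion_finset (μ := πA) hd (fun k _ => measurableSet_Ioc)
  have h2 : ∑ k ∈ Finset.range n, (1 / (n : ℝ)) <
      ∑ k ∈ Finset.range n, πA.real (Set.Ioc ((k : ℝ) / n) (((k : ℝ) + 1) / n)) :=
    Finset.sum_lt_sum_of_nonempty ⟨0, by simpa using hn⟩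
      (fun k hk => h k (by simpa using hk))
  rw [← h1] at h2
  have h3 : ∑ k ∈ Finset.range n, (1 / (n : ℝ)) = 1 := by
    simp; field_simp
  rw [h3] at h2
  exact absurd (measureReal_le_one (μ := πA)) (not_le.mpr h2)

lemma phi_bound {r : ℝ → ℝ} (y y' : ℝ) : 0 ≤ phi r y y' ∧ phi r y y' ≤ 1 := by
  unfold phi
  split_ifs with h1 h2 h2
  · exact absurd h2 (ne_of_gt h1)
  all_goals norm_num

lemma epw_le (μ : Measure ℝ) [IsProbabilityMeasure μ] (r s : ℝ → ℝ) (T : Set ℝ)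
    (hT : MeasurableSet T) (h : ∀ y, y ∉ T → s y = r y) : epw μ r s ≤ 2 * μ.real T := by
  unfold epw
  have hi : Integrable (T.indicator (fun _ => (1 : ℝ))) μ := (integrable_const 1).indicator hT
  have hb : ∀ y y', |phi r y y' - phi s y y'| ≤
      T.indicator (fun _ => (1 : ℝ)) y + T.indicator (fun _ => (1 : ℝ)) y' := by
    intro y y'
    have h1 : |phi r y y' - phi s y y'| ≤ 1 := by
      have := phi_bound (r := r) y y'
      have := phi_bound (r := s) y y'
      rw [abs_le]; constructor <;> linarith
    by_cases hy : y ∈ T <;> by_cases hy' : y' ∈ T <;> simp [hy, hy'] <;> try linarith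
    simp [phi, h y hy, h y' hy']
  have hI : ∫ y, T.indicator (fun _ => (1 : ℝ)) y ∂μ = μ.real T := by
    rw [integral_indicator hT]; simp
  calc _ ≤ ∫ y, (T.indicator (fun _ => (1 : ℝ)) y + μ.real T) ∂μ := by
        apply integral_mono_of_nonneg
        · exact Filter.Eventually.of_forall fun y => integral_nonneg fun _ => abs_nonneg _
        · exact hi.add (integrable_const _)
        · refine Filter.Eventually.of_forall fun y => ?_
          calc _ ≤ ∫ y', (T.indicator (fun _ => (1 : ℝ)) y
                  + T.indicator (fun _ => (1 : ℝ)) y') ∂μ := by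
                apply integral_mono_of_nonneg
                · exact Filter.Eventually.of_forall fun _ => abs_nonneg _
                · exact (integrable_const _).add hi
                · exact Filter.Eventually.of_forall fun y' => hb y y'
            _ = _ := by
                rw [integral_add (integrable_const _) hi, hI]; simp
    _ = _ := by
        rw [integral_add hi (integrable_const _), hI]; simp; ring

lemma exists_pistar (μ : Measure ℝ) [IsProbabilityMeasure μ] (T : Set ℝ) (hT : MeasurableSet T)
    (M ε t : ℝ) (hM : 2 ≤ M) (hε0 : 0 < ε) (ht : μ.real T = t) (ht0 : 0 < t)
    (htM : M * t + ε * M ≤ 1) :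
    ∃ ν : Measure ℝ, IsProbabilityMeasure ν ∧ ν ≪ μ ∧ EMdiv M ν μ = ε * M ∧
      ν.real T = M * t + ε * M := by
  have ht1 : t < 1 := by nlinarith
  set c : ℝ := M + ε * M / t with hc
  set d : ℝ := (1 - M * t - ε * M) / (1 - t) with hd
  have hct : c * t = M * t + ε * M := by rw [hc]; field_simp
  have hc0 : 0 ≤ c := by positivity
  have hcM : M ≤ c := by rw [hc]; have : 0 ≤ ε * M / t := by positivity
                         linarith
  have hd0 : 0 ≤ d := div_nonneg (by linarith) (by linarith)
  have hdt : d * (1 - t) = 1 - M * t - ε * M := div_mul_cancel₀ _ (by linarith)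
  have hdM : d ≤ M := by
    rw [hd, div_le_iff₀ (by linarith)]; nlinarith
  have hTe : μ T = ENNReal.ofReal t := by rw [← ht, ofReal_measureReal]
  have hTc : μ Tᶜ = ENNReal.ofReal (1 - t) := by
    rw [← ht, ← probReal_compl_eq_one_sub hT, ofReal_measureReal]
  let f : ℝ → ℝ≥0∞ := fun y => T.indicator (fun _ => ENNReal.ofReal c) y
    + Tᶜ.indicator (fun _ => ENNReal.ofReal d) y
  have hf : Measurable f :=
    (measurable_const.indicator hT).add (measurable_const.indicator hT.compl)
  have hνT : (μ.withDensity f) T = ENNReal.ofReal (c * t) := by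
    rw [withDensity_apply _ hT, setLIntegral_congr_fun hT (g := fun _ => ENNReal.ofReal c)
      (fun y hy => by simp [f, hy]), setLIntegral_const, hTe, ENNReal.ofReal_mul hc0]
  have hνTc : (μ.withDensity f) Tᶜ = ENNReal.ofReal (d * (1 - t)) := by
    rw [withDensity_apply _ hT.compl, setLIntegral_congr_fun hT.compl
      (g := fun _ => ENNReal.ofReal d)
      (fun y hy => by
        have hy' : y ∉ T := hy
        simp [f, hy']), setLIntegral_const, hTc, ENNReal.ofReal_mul hd0]
  refine ⟨μ.withDensity f, ⟨?_⟩, withDensity_absolutelyContinuous _ _, ?_, ?_⟩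
  · rw [← measure_add_measure_compl hT, hνT, hνTc, ← ENNReal.ofReal_add (by positivity)
      (by rw [hdt]; linarith), hct, hdt]
    simp
  · unfold EMdiv
    have h1 : (fun y => max (((μ.withDensity f).rnDeriv μ y).toReal - M) 0) =ᵐ[μ]
        T.indicator (fun _ => c - M) := by
      filter_upwards [Measure.rnDeriv_withDensity μ hf] with y hy
      rw [hy]
      by_cases hyT : y ∈ T
      · simp [f, hyT, hc0, hcM]
      · simp [f, hyT, hd0, hdM]
    rw [integral_congr_ae h1, integral_indicator hT]
    simp [ht]
    linarith
  · rw [measureReal_def, hνT, ENNReal.toReal_ofReal (by positivity), hct]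

/-- **Impossibility of bounding expected-reward regret via pairwise error and
`E_M`-divergence.** With `Y = [0,1]`, `πref` uniform, `S = [0, 1/M]`, and
`r̂ = R_max·1_S`, for every policy `π_A` and every target gap `γ > 0` there exist a
bounded measurable nonnegative reward `r⋆` and a comparator `π⋆ ≪ πref` with
`ε_pw(r̂) ≤ ε`, `E_M(π⋆ ‖ πref) = ε·M`, and `∫ r⋆ dπ⋆ − ∫ r⋆ dπ_A ≥ γ`. -/
theorem stmt_10 (M ε Rmax : ℝ) (hM : 2 ≤ M) (hε0 : 0 < ε) (hε : ε < 1 / M)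
    (hR : 0 < Rmax) :
    let πref : Measure ℝ := volume.restrict (Set.Icc 0 1)
    let S : Set ℝ := Set.Icc 0 (1 / M)
    let rhat : ℝ → ℝ := S.indicator fun _ => Rmax
    ∀ πA : Measure ℝ, IsProbabilityMeasure πA → ∀ γ : ℝ, 0 < γ →
      ∃ rstar : ℝ → ℝ, Measurable rstar ∧ (∀ y, 0 ≤ rstar y) ∧ (∃ B : ℝ, ∀ y, rstar y ≤ B) ∧
        ∃ πstar : Measure ℝ, IsProbabilityMeasure πstar ∧ πstar ≪ πref ∧
          epw πref rhat rstar ≤ ε ∧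
          EMdiv M πstar πref = ε * M ∧
          γ ≤ (∫ y, rstar y ∂πstar) - ∫ y, rstar y ∂πA := by
  intro πref S rhat πA hA γ hγ
  have hM0 : 0 < M := by linarith
  have hεM : ε * M < 1 := by rwa [lt_div_iff₀ hM0] at hε
  haveI : IsProbabilityMeasure πref := ⟨by simp [πref]⟩
  have hx : 0 < 1 - ε * M := by linarith
  obtain ⟨n, hn⟩ := exists_nat_gt (2 / ε + M / (1 - ε * M) + 2 / (ε * M))
  have p1 : 0 < 2 / ε := by positivity
  have p2 : 0 < M / (1 - ε * M) := by positivity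
  have p3 : 0 < 2 / (ε * M) := by positivity
  have hn0 : (0 : ℝ) < n := by linarith
  have q1 : 2 / ε < n := by linarith
  have q2 : M / (1 - ε * M) < n := by linarith
  have q3 : 2 / (ε * M) < n := by linarith
  rw [div_lt_iff₀ (by positivity)] at q1 q2 q3
  set t : ℝ := 1 / n with ht
  have ht0 : 0 < t := by positivity
  have hnt : n * t = 1 := by rw [ht]; field_simp
  have r1 : 2 * t ≤ ε := by nlinarith
  have r2 : M * t + ε * M ≤ 1 := by nlinarith
  have r3 : t ≤ ε * M / 2 := by nlinarith
  obtain ⟨k, hk, hkA⟩ := exists_small πA n (by exact_mod_cast hn0)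
  set T : Set ℝ := Set.Ioc ((k : ℝ) / n) (((k : ℝ) + 1) / n) with hTdef
  have hT : MeasurableSet T := measurableSet_Ioc
  have hTsub : T ⊆ Set.Icc 0 1 := by
    rintro y ⟨h1, h2⟩
    have hk' : (k : ℝ) + 1 ≤ n := by exact_mod_cast hk
    have : (k : ℝ) / n ≥ 0 := by positivity
    have : ((k : ℝ) + 1) / n ≤ 1 := by rwa [div_le_one hn0]
    constructor <;> linarith
  have hTm : πref.real T = t := by
    simp only [πref]
    rw [measureReal_restrict_apply hT, Set.inter_eq_left.mpr hTsub, hTdef, Real.volume_real_Ioc,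
      max_eq_left]
    · rw [ht]; ring
    · rw [← sub_div]; simp
  obtain ⟨ν, hν, hac, hE, hνT⟩ := exists_pistar πref T hT M ε t hM hε0 hTm ht0 r2
  set K : ℝ := 2 * (γ + Rmax) / (ε * M) with hK
  have hK0 : 0 ≤ K := by positivity
  have hKe : K * (ε * M) = 2 * (γ + Rmax) := by rw [hK]; field_simp
  have hrm : Measurable rhat := measurable_const.indicator measurableSet_Icc
  have hr0 : ∀ y, 0 ≤ rhat y := fun y => Set.indicator_nonneg (fun _ _ => hR.le) y
  have hr1 : ∀ y, rhat y ≤ Rmax := fun y => Set.indicator_le_self' (fun _ _ => hR.le) y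
  have hKm : Measurable (T.indicator fun _ => K) := measurable_const.indicator hT
  have hK1 : ∀ y, 0 ≤ T.indicator (fun _ => K) y := fun y =>
    Set.indicator_nonneg (fun _ _ => hK0) y
  have hK2 : ∀ y, T.indicator (fun _ => K) y ≤ K := fun y =>
    Set.indicator_le_self' (fun _ _ => hK0) y
  have hint : ∀ (μ : Measure ℝ), IsProbabilityMeasure μ →
      ∫ y, (rhat y + T.indicator (fun _ => K) y) ∂μ = ∫ y, rhat y ∂μ + K * μ.real T ∧
      0 ≤ ∫ y, rhat y ∂μ ∧ ∫ y, rhat y ∂μ ≤ Rmax := by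
    intro μ _
    have hi : Integrable rhat μ := (integrable_const Rmax).indicator measurableSet_Icc
    refine ⟨?_, integral_nonneg hr0, ?_⟩
    · rw [integral_add hi ((integrable_const K).indicator hT), integral_indicator hT]
      simp [mul_comm]
    · calc _ ≤ ∫ _, Rmax ∂μ := integral_mono hi (integrable_const _) hr1
        _ = _ := by simp
  refine ⟨fun y => rhat y + T.indicator (fun _ => K) y, hrm.add hKm,
    fun y => add_nonneg (hr0 y) (hK1 y), ⟨Rmax + K, fun y => add_le_add (hr1 y) (hK2 y)⟩,
    ν, hν, hac, ?_, hE, ?_⟩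
  · refine (epw_le πref rhat _ T hT fun y hy => by simp [hy]).trans ?_
    rw [hTm]; exact r1
  · obtain ⟨a1, a2, a3⟩ := hint ν hν
    obtain ⟨b1, b2, b3⟩ := hint πA hA
    rw [a1, b1, hνT]
    have e1 : K * πA.real T ≤ K * (ε * M / 2) := mul_le_mul_of_nonneg_left (hkA.trans r3) hK0
    have e2 : 0 ≤ K * (M * t) := by positivity
    nlinarith
end
end

section
/- Let Y be a measurable space, π_ref a probability measure on Y, π⋆ a probability measure with π⋆ ≪ π_ref, and M ≥ 1 a real number. Then there exists a probability measure π on Y with π ≪ π_ref, dπ/dπ_ref ≤ M π_ref-almost everywhere, and TV(π, π⋆) = E_M(π⋆ ‖ π_ref), where TV denotes the total variation distance. In particular, the minimal total variation distance from π⋆ to the set of policies with density ratio bounded by M is exactly E_M(π⋆ ‖ π_ref). -/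
open MeasureTheory ENNReal

noncomputable section

theorem tv_bdd {Y : Type*} [MeasurableSpace Y] (μ ν : Measure Y) [IsProbabilityMeasure μ]
    [IsProbabilityMeasure ν] :
    BddAbove (Set.range fun A : {A : Set Y // MeasurableSet A} =>
      |(μ A.1).toReal - (ν A.1).toReal|) := by
  refine ⟨1, ?_⟩
  rintro _ ⟨A, rfl⟩
  have h1 : (μ A.1).toReal ≤ 1 := measureReal_le_one
  have h2 : (ν A.1).toReal ≤ 1 := measureReal_le_one
  have h3 : 0 ≤ (μ A.1).toReal := ENNReal.toReal_nonneg
  have h4 : 0 ≤ (ν A.1).toReal := ENNReal.toReal_nonneg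
  exact abs_le.2 ⟨by linarith, by linarith⟩

theorem lower_bd {Y : Type*} [MeasurableSpace Y]
    (πref : Measure Y) [IsProbabilityMeasure πref]
    (πstar : Measure Y) [IsProbabilityMeasure πstar] (hac : πstar ≪ πref)
    (M : ℝ) (π : Measure Y) (hp : IsProbabilityMeasure π) (hπ : π ≪ πref)
    (hb : ∀ᵐ y ∂πref, (π.rnDeriv πref y).toReal ≤ M) :
    EMdiv M πstar πref ≤ TV π πstar := by
  have hm : Measurable fun y => (πstar.rnDeriv πref y).toReal :=
    (Measure.measurable_rnDeriv _ _).ennreal_toReal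
  have hA : MeasurableSet {y | M < (πstar.rnDeriv πref y).toReal} :=
    measurableSet_lt measurable_const hm
  have hfi : Integrable (fun y => (πstar.rnDeriv πref y).toReal) πref :=
    Measure.integrable_toReal_rnDeriv
  have hgi : Integrable (fun y => (π.rnDeriv πref y).toReal) πref :=
    Measure.integrable_toReal_rnDeriv
  refine le_trans ?_ (le_ciSup (tv_bdd π πstar) ⟨_, hA⟩)
  refine le_trans ?_ (neg_le_abs _)
  have e1 := Measure.setIntegral_toReal_rnDeriv hac {y | M < (πstar.rnDeriv πref y).toReal}
  have e2 := Measure.setIntegral_toReal_rnDeriv hπ {y | M < (πstar.rnDeriv πref y).toReal}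
  simp only [Measure.real] at e1 e2
  rw [neg_sub, ← e1, ← e2, ← integral_sub hfi.integrableOn hgi.integrableOn, EMdiv,
    ← integral_indicator hA]
  refine integral_mono_ae ((hfi.sub (integrable_const M)).pos_part)
    ((hfi.sub hgi).indicator hA) ?_
  filter_upwards [hb] with y hy
  by_cases h : M < (πstar.rnDeriv πref y).toReal
  · rw [Set.indicator_of_mem (by exact h), max_eq_left (by linarith)]
    linarith
  · rw [Set.indicator_of_notMem (by exact h), max_eq_right (by linarith)]

/-- **Optimal `M`-capped TV projection.** For `π⋆ ≪ πref` and `M ≥ 1` there is a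
probability measure `π ≪ πref` with density ratio bounded by `M` `πref`-a.e. and
`TV(π, π⋆) = E_M(π⋆ ‖ πref)`; moreover every such `M`-capped policy is at TV distance at
least `E_M(π⋆ ‖ πref)` from `π⋆`, so the minimal distance is exactly `E_M(π⋆ ‖ πref)`. -/
theorem stmt_13 {Y : Type*} [MeasurableSpace Y]
    (πref : Measure Y) [IsProbabilityMeasure πref]
    (πstar : Measure Y) [IsProbabilityMeasure πstar] (hac : πstar ≪ πref)
    (M : ℝ) (hM : 1 ≤ M) :
    (∃ π : Measure Y, IsProbabilityMeasure π ∧ π ≪ πref ∧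
      (∀ᵐ y ∂πref, (π.rnDeriv πref y).toReal ≤ M) ∧
      TV π πstar = EMdiv M πstar πref) ∧
    ∀ π : Measure Y, IsProbabilityMeasure π → π ≪ πref →
      (∀ᵐ y ∂πref, (π.rnDeriv πref y).toReal ≤ M) →
      EMdiv M πstar πref ≤ TV π πstar := by
  refine ⟨?_, fun π hp hπ hb => lower_bd πref πstar hac M π hp hπ hb⟩
  set f : Y → ℝ := fun y => (πstar.rnDeriv πref y).toReal with hf
  have hm : Measurable f := (Measure.measurable_rnDeriv _ _).ennreal_toReal
  have hfi : Integrable f πref := Measure.integrable_toReal_rnDeriv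
  have hf0 : ∀ y, 0 ≤ f y := fun y => ENNReal.toReal_nonneg
  set E : ℝ := ∫ y, max (f y - M) 0 ∂πref with hE
  set S : ℝ := ∫ y, max (M - f y) 0 ∂πref with hS
  have iE : Integrable (fun y => max (f y - M) 0) πref :=
    (hfi.sub (integrable_const M)).pos_part
  have iS : Integrable (fun y => max (M - f y) 0) πref :=
    ((integrable_const M).sub hfi).pos_part
  have hE0 : 0 ≤ E := integral_nonneg fun y => le_max_right _ _
  have hf1 : ∫ y, f y ∂πref = 1 := by
    rw [Measure.integral_toReal_rnDeriv hac]; simp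
  have hSE : S - E = M - 1 := by
    rw [hS, hE, ← integral_sub iS iE, ← hf1]
    have : M = ∫ _, M ∂πref := by simp
    conv_rhs => rw [this]
    rw [← integral_sub (integrable_const M) hfi]
    congr 1
    funext y
    rcases le_total (f y) M with h | h
    · rw [max_eq_left (by linarith), max_eq_right (by linarith)]; ring
    · rw [max_eq_right (by linarith), max_eq_left (by linarith)]; ring
  obtain ⟨c, hc0, hc1, hcS⟩ : ∃ c : ℝ, 0 ≤ c ∧ c ≤ 1 ∧ c * S = E := by
    rcases eq_or_lt_of_le (show 0 ≤ S by linarith) with h | h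
    · exact ⟨0, le_rfl, zero_le_one, by linarith⟩
    · exact ⟨E / S, div_nonneg hE0 h.le, (div_le_one h).2 (by linarith),
        div_mul_cancel₀ _ h.ne'⟩
  set g : Y → ℝ := fun y => f y + (c * max (M - f y) 0 - max (f y - M) 0) with hg
  have hgm : Measurable g := by fun_prop
  have hgM : ∀ y, 0 ≤ g y ∧ g y ≤ M := by
    intro y
    have := hf0 y
    simp only [hg]
    rcases le_total (f y) M with h | h
    · rw [max_eq_left (by linarith), max_eq_right (by linarith)]
      constructor <;> nlinarith
    · rw [max_eq_right (by linarith), max_eq_left (by linarith)]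
      constructor <;> linarith
  have ih : Integrable (fun y => c * max (M - f y) 0 - max (f y - M) 0) πref :=
    (iS.const_mul c).sub iE
  have hgi : Integrable g πref := hfi.add ih
  have hg1 : ∫ y, g y ∂πref = 1 := by
    rw [integral_add hfi ih, integral_sub (iS.const_mul c) iE, integral_const_mul, hf1]
    linarith
  set π : Measure Y := πref.withDensity fun y => ENNReal.ofReal (g y) with hπd
  have hset : ∀ A, MeasurableSet A → (π A).toReal = ∫ y in A, g y ∂πref := by
    intro A hA
    rw [hπd, withDensity_apply _ hA, integral_eq_lintegral_of_nonneg_ae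
      (Filter.Eventually.of_forall fun y => (hgM y).1) hgm.aestronglyMeasurable]
  have hπp : IsProbabilityMeasure π := by
    constructor
    rw [hπd, withDensity_apply _ MeasurableSet.univ, Measure.restrict_univ,
      ← ofReal_integral_eq_lintegral_ofReal hgi
        (Filter.Eventually.of_forall fun y => (hgM y).1), hg1, ENNReal.ofReal_one]
  have hπac : π ≪ πref := withDensity_absolutelyContinuous _ _
  have hπb : ∀ᵐ y ∂πref, (π.rnDeriv πref y).toReal ≤ M := by
    filter_upwards [Measure.rnDeriv_withDensity πref hgm.ennreal_ofReal] with y hy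
    rw [hπd, hy, ENNReal.toReal_ofReal (hgM y).1]
    exact (hgM y).2
  refine ⟨π, hπp, hπac, hπb, le_antisymm ?_ (lower_bd πref πstar hac M π hπp hπac hπb)⟩
  haveI : Nonempty {A : Set Y // MeasurableSet A} := ⟨⟨∅, MeasurableSet.empty⟩⟩
  refine ciSup_le ?_
  rintro ⟨A, hA⟩
  have e1 := Measure.setIntegral_toReal_rnDeriv hac A
  simp only [Measure.real] at e1
  change |(π A).toReal - (πstar A).toReal| ≤ E
  rw [hset A hA, ← e1, integral_add hfi.integrableOn ih.integrableOn, add_sub_cancel_left,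
    integral_sub (iS.const_mul c).integrableOn iE.integrableOn, integral_const_mul]
  have a1 : ∫ y in A, max (M - f y) 0 ∂πref ≤ S :=
    setIntegral_le_integral iS (Filter.Eventually.of_forall fun y => le_max_right _ _)
  have a2 : ∫ y in A, max (f y - M) 0 ∂πref ≤ E :=
    setIntegral_le_integral iE (Filter.Eventually.of_forall fun y => le_max_right _ _)
  have a3 : 0 ≤ ∫ y in A, max (M - f y) 0 ∂πref := integral_nonneg fun y => le_max_right _ _
  have a4 : 0 ≤ ∫ y in A, max (f y - M) 0 ∂πref := integral_nonneg fun y => le_max_right _ _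
  have a5 := mul_le_mul_of_nonneg_left a1 hc0
  have a6 := mul_nonneg hc0 a3
  exact abs_le.2 ⟨by linarith, by linarith⟩
end
end

section
/- Let Y be a finite nonempty set, let π_ref be a probability measure on Y with π_ref({y}) > 0 for all y ∈ Y, let s : Y → [0,1], and fix reals M ≥ 2 and β ≥ 1. Consider the program of maximizing J(w) = ∑_y π_ref({y})·w(y)·s(y) − β·∑_y π_ref({y})·max(w(y) − M, 0) over all w : Y → [0,∞) with ∑_y π_ref({y})·w(y) = 1. Then there exists a maximizer w⋆ of J satisfying 0 ≤ w⋆(y) ≤ M for all y; consequently, the optimal value of this program equals the maximum of ∑_y π_ref({y})·w(y)·s(y) over all w : Y → [0, M] with ∑_y π_ref({y})·w(y) = 1. -/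
open MeasureTheory ENNReal

noncomputable section

/-- **The `E_M`-penalized program reduces to the capped program (finite case).** On a
finite set with full-support reference weights, scores `s : Y → [0,1]`, `M ≥ 2`, and
`β ≥ 1`, the objective `J(w) = ∑ p(y) w(y) s(y) − β ∑ p(y) (w(y) − M)_+` over
`w ≥ 0` with `∑ p(y) w(y) = 1` admits a maximizer `w⋆` with `0 ≤ w⋆ ≤ M`; consequently
the optimal value equals the maximum of the capped linear program. -/
theorem stmt_14 {Y : Type*} [Fintype Y] [Nonempty Y] [MeasurableSpace Y]
    [MeasurableSingletonClass Y]
    (πref : Measure Y) [IsProbabilityMeasure πref]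
    (hpos : ∀ y : Y, 0 < (πref {y}).toReal)
    (s : Y → ℝ) (hs : ∀ y, s y ∈ Set.Icc (0 : ℝ) 1)
    (M β : ℝ) (hM : 2 ≤ M) (hβ : 1 ≤ β) :
    ∃ wstar : Y → ℝ,
      (∀ y, 0 ≤ wstar y ∧ wstar y ≤ M) ∧
      (∑ y : Y, (πref {y}).toReal * wstar y = 1) ∧
      ∀ w : Y → ℝ, (∀ y, 0 ≤ w y) → (∑ y : Y, (πref {y}).toReal * w y = 1) →
        (∑ y : Y, (πref {y}).toReal * w y * s y) -
            β * ∑ y : Y, (πref {y}).toReal * max (w y - M) 0 ≤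
          ∑ y : Y, (πref {y}).toReal * wstar y * s y := by
  classical
  have hp1 : ∑ y : Y, (πref {y}).toReal = 1 := by
    have h := sum_measureReal_singleton (μ := πref) (Finset.univ : Finset Y)
    simpa [Measure.real] using h
  set p : Y → ℝ := fun y => (πref {y}).toReal with hp
  change ∀ y, 0 < p y at hpos
  change ∑ y, p y = 1 at hp1
  change ∃ wstar : Y → ℝ,
      (∀ y, 0 ≤ wstar y ∧ wstar y ≤ M) ∧
      (∑ y : Y, p y * wstar y = 1) ∧
      ∀ w : Y → ℝ, (∀ y, 0 ≤ w y) → (∑ y : Y, p y * w y = 1) →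
        (∑ y : Y, p y * w y * s y) -
            β * ∑ y : Y, p y * max (w y - M) 0 ≤
          ∑ y : Y, p y * wstar y * s y
  clear_value p
  let K : Set (Y → ℝ) := Set.pi Set.univ (fun _ => Set.Icc (0 : ℝ) M) ∩ {w | ∑ y, p y * w y = 1}
  have hK : IsCompact K := by
    refine (isCompact_univ_pi fun _ => isCompact_Icc).inter_right ?_
    exact isClosed_eq (by fun_prop) continuous_const
  have hne : K.Nonempty := by
    refine ⟨fun _ => 1, fun y _ => ⟨zero_le_one, by linarith⟩, ?_⟩
    simpa using hp1
  obtain ⟨ws, ⟨hw1, hw2⟩, hmax⟩ := hK.exists_isMaxOn hne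
    (f := fun w => ∑ y, p y * w y * s y) (by fun_prop)
  refine ⟨ws, fun y => hw1 y trivial, hw2, fun w hw hws => ?_⟩
  set e := ∑ y, p y * max (w y - M) 0 with he
  have he0 : 0 ≤ e := Finset.sum_nonneg fun y _ => mul_nonneg (hpos y).le (le_max_right _ _)
  have hD : 0 < M - 1 + e := by linarith
  set t := e / (M - 1 + e) with ht
  have ht0 : 0 ≤ t := div_nonneg he0 hD.le
  have ht1 : t ≤ 1 := by rw [ht, div_le_one hD]; linarith
  have htD : t * (M - 1 + e) = e := div_mul_cancel₀ _ hD.ne'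
  set m : Y → ℝ := fun y => w y - max (w y - M) 0 with hm
  have hm0 : ∀ y, 0 ≤ m y := fun y => by
    have := hw y
    have : max (w y - M) 0 ≤ w y := max_le (by linarith) this
    simp only [hm]; linarith
  have hmM : ∀ y, m y ≤ M := fun y => by
    have := le_max_left (w y - M) 0
    simp only [hm]; linarith
  have hms : ∑ y, p y * m y = 1 - e := by
    simp only [hm, mul_sub, Finset.sum_sub_distrib]
    simp only [← mul_sub, hws, he]
  have hmem : (fun y => m y + t * (M - m y)) ∈ K := by
    refine ⟨fun y _ => ⟨?_, ?_⟩, ?_⟩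
    · have := mul_nonneg ht0 (sub_nonneg.2 (hmM y))
      have := hm0 y
      simp only; linarith
    · have := mul_nonneg (sub_nonneg.2 ht1) (sub_nonneg.2 (hmM y))
      simp only; linarith
    · change ∑ y, p y * (m y + t * (M - m y)) = 1
      have : ∀ y, p y * (m y + t * (M - m y)) = (1 - t) * (p y * m y) + t * M * p y :=
        fun y => by ring
      simp only [this, Finset.sum_add_distrib, ← Finset.mul_sum, hms, hp1]
      linarith
  have h1 := hmax hmem
  simp only [Set.mem_setOf_eq] at h1
  refine le_trans ?_ h1
  have h2 : (∑ y : Y, p y * w y * s y) - e ≤ ∑ y, p y * (m y + t * (M - m y)) * s y := by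
    rw [he, ← Finset.sum_sub_distrib]
    refine Finset.sum_le_sum fun y _ => ?_
    have a1 := mul_nonneg (mul_nonneg (hpos y).le (hs y).1)
      (mul_nonneg ht0 (sub_nonneg.2 (hmM y)))
    have a2 := mul_nonneg (mul_nonneg (hpos y).le (le_max_right (w y - M) 0))
      (sub_nonneg.2 (hs y).2)
    have a3 : w y = m y + max (w y - M) 0 := by simp only [hm]; ring
    have a4 : p y * w y * s y = p y * m y * s y + p y * max (w y - M) 0 * s y := by
      conv_lhs => rw [a3]
      ring
    linarith
  nlinarith
end
end

section
/- Let Y be a measurable space, π_ref a probability measure on Y, s : Y → ℝ measurable, and M ≥ 1 a real number, and suppose λ ∈ ℝ satisfies π_ref({y : s(y) ≥ λ}) = 1/M. Let π_λ = π_ref(· | s(·) ≥ λ) be the top-(1/M) threshold policy. Then for every probability measure π on Y with π ≪ π_ref and dπ/dπ_ref ≤ M π_ref-almost everywhere, ∫ s dπ ≤ ∫ s dπ_λ; that is, among all policies whose density ratio with respect to π_ref is bounded by M, the expected score ∫ s dπ is maximized by the threshold policy π_λ, whose density ratio is M·1{s ≥ λ}. -/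
open MeasureTheory ENNReal

noncomputable section

/-- **The top-`1/M` threshold policy maximizes expected score among `M`-capped policies.**
If `πref({s ≥ λ}) = 1/M`, then for every probability measure `π ≪ πref` whose density
ratio is bounded by `M` `πref`-a.e., `∫ s dπ ≤ ∫ s dπ_λ` where
`π_λ = πref(·| s ≥ λ)`. -/
theorem stmt_15 {Y : Type*} [MeasurableSpace Y]
    (πref : Measure Y) [IsProbabilityMeasure πref]
    (s : Y → ℝ) (hmeas : Measurable s) (hint : Integrable s πref)
    (M : ℝ) (hM : 1 ≤ M) (lam : ℝ)
    (hlam : πref {y | lam ≤ s y} = ENNReal.ofReal (1 / M)) :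
    ∀ π : Measure Y, IsProbabilityMeasure π → π ≪ πref →
      (∀ᵐ y ∂πref, (π.rnDeriv πref y).toReal ≤ M) →
      ∫ y, s y ∂π ≤
        ∫ y, s y ∂((πref {y | lam ≤ s y})⁻¹ • πref.restrict {y | lam ≤ s y}) := by
  intro π hπ hac hb
  have hA : MeasurableSet {y | lam ≤ s y} := measurableSet_le measurable_const hmeas
  have hM0 : 0 < M := by linarith
  have hc : ((πref {y | lam ≤ s y})⁻¹).toReal = M := by
    rw [hlam, ENNReal.toReal_inv, ENNReal.toReal_ofReal (by positivity)]
    simp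
  have hr : (πref.real {y | lam ≤ s y}) = 1 / M := by
    rw [Measure.real, hlam, ENNReal.toReal_ofReal (by positivity)]
  rw [integral_smul_measure, hc, ← integral_rnDeriv_smul hac, ← integral_indicator hA]
  set f : Y → ℝ := fun y => (π.rnDeriv πref y).toReal with hf
  have hfm : Measurable f := (Measure.measurable_rnDeriv π πref).ennreal_toReal
  have hfi : Integrable f πref := Measure.integrable_toReal_rnDeriv
  have hf1 : ∫ y, f y ∂πref = 1 := by
    rw [hf, Measure.integral_toReal_rnDeriv hac]
    simp
  have hf0 : ∀ y, 0 ≤ f y := fun y => ENNReal.toReal_nonneg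
  have hfs : Integrable (fun y => f y * s y) πref := by
    refine hint.bdd_mul (c := M) hfm.aestronglyMeasurable ?_
    filter_upwards [hb] with y hy
    rw [Real.norm_of_nonneg (hf0 y)]
    exact hy
  have hsi : Integrable ({y | lam ≤ s y}.indicator s) πref := hint.indicator hA
  have h1i : Integrable ({y | lam ≤ s y}.indicator (fun _ => (1:ℝ))) πref :=
    (integrable_const 1).indicator hA
  have h11 : ∫ y, {y | lam ≤ s y}.indicator (fun _ => (1:ℝ)) y ∂πref = 1 / M := by
    rw [integral_indicator hA]
    simp [hr]
  have key : ∫ y, f y * s y ∂πref ≤ ∫ y, (M * {y | lam ≤ s y}.indicator s y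
      - lam * (M * {y | lam ≤ s y}.indicator (fun _ => (1:ℝ)) y - f y)) ∂πref := by
    refine integral_mono_ae hfs
      ((hsi.const_mul M).sub (((h1i.const_mul M).sub hfi).const_mul lam)) ?_
    filter_upwards [hb] with y hy
    have hy' : f y ≤ M := hy
    have h0 := hf0 y
    by_cases h : lam ≤ s y
    · simp [Set.indicator, h]
      nlinarith
    · simp [Set.indicator, h]
      push Not at h
      nlinarith
  have hd : Integrable (fun y => lam * (M * {y | lam ≤ s y}.indicator (fun _ => (1:ℝ)) y
      - f y)) πref := ((h1i.const_mul M).sub hfi).const_mul lam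
  rw [integral_sub (hsi.const_mul M) hd,
    integral_const_mul, integral_const_mul, integral_sub (h1i.const_mul M) hfi,
    integral_const_mul, h11, hf1] at key
  have : M * (1 / M) = 1 := by field_simp
  rw [this] at key
  simpa using key
end
end
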